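/- Let (X,f) and (Y,g) be transitive finitely presented systems and π : X → Y a finite-to-one factor map. Then there exist Smale spaces (X̃, f̃) and (Ỹ, g̃) and factor maps φ : X̃ → X, θ : Ỹ → Y, π̃ : X̃ → Ỹ such that φ and θ are u-resolving, π̃ is s-resolving, and π ∘ φ = θ ∘ π̃. -/

import Mathlib

open Filter Topology Set

/-- `f` is expansive with expansive constant `c`. -/
def Expansive {X : Type*} [MetricSpace X] (f : Equiv.Perm X) (c : ℝ) : Prop :=
  ∀ p q : X, p ≠ q → ∃ n : ℤ, c < dist ((f ^ n) p) ((f ^ n) q)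

/-- The ε-stable set of `x`. -/
def Ws {X : Type*} [MetricSpace X] (f : Equiv.Perm X) (ε : ℝ) (x : X) : Set X :=
  {y | ∀ n : ℕ, dist ((f ^ (n : ℤ)) x) ((f ^ (n : ℤ)) y) < ε}

/-- The ε-unstable set of `x`. -/
def Wu {X : Type*} [MetricSpace X] (f : Equiv.Perm X) (ε : ℝ) (x : X) : Set X :=
  {y | ∀ n : ℕ, dist ((f ^ (-(n : ℤ))) x) ((f ^ (-(n : ℤ))) y) < ε}

/-- The stable set of `x`. -/
def stableSet {X : Type*} [MetricSpace X] (f : Equiv.Perm X) (x : X) : Set X :=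
  {y | Filter.Tendsto (fun n : ℕ => dist ((f ^ (n : ℤ)) x) ((f ^ (n : ℤ)) y))
    Filter.atTop (nhds 0)}

/-- The unstable set of `x`. -/
def unstableSet {X : Type*} [MetricSpace X] (f : Equiv.Perm X) (x : X) : Set X :=
  {y | Filter.Tendsto (fun n : ℕ => dist ((f ^ (-(n : ℤ))) x) ((f ^ (-(n : ℤ))) y))
    Filter.atTop (nhds 0)}

/-- Canonical coordinates: for all sufficiently small ε > 0 there is δ > 0 such that
points at distance < δ have a unique bracket `[x,y] = W^s_ε(x) ∩ W^u_ε(y)`. -/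
def CanonicalCoords {X : Type*} [MetricSpace X] (f : Equiv.Perm X) : Prop :=
  ∃ ε₀ > 0, ∀ ε : ℝ, 0 < ε → ε ≤ ε₀ → ∃ δ > 0, ∀ x y : X, dist x y < δ →
    ∃! z, z ∈ Ws f ε x ∩ Wu f ε y

/-- A Smale space: an expansive homeomorphism with canonical coordinates. -/
def IsSmale {X : Type*} [MetricSpace X] (f : Equiv.Perm X) : Prop :=
  Continuous (⇑f) ∧ Continuous (⇑f.symm) ∧ (∃ c > 0, Expansive f c) ∧ CanonicalCoords f

/-- Topological transitivity. -/
def TopTransitive {X : Type*} [MetricSpace X] (f : Equiv.Perm X) : Prop :=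
  ∀ U V : Set X, IsOpen U → IsOpen V → U.Nonempty → V.Nonempty →
    ∃ n : ℕ, ((f ^ (n : ℤ)) ⁻¹' U ∩ V).Nonempty

/-- A periodic point of `f`. -/
def IsPeriodicPoint {X : Type*} [MetricSpace X] (f : Equiv.Perm X) (p : X) : Prop :=
  ∃ N : ℕ, 0 < N ∧ (f ^ (N : ℤ)) p = p

/-- A factor map (surjective continuous semiconjugacy). -/
def IsFactorMap {X Y : Type*} [MetricSpace X] [MetricSpace Y]
    (F : Equiv.Perm X) (f : Equiv.Perm Y) (π : X → Y) : Prop :=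
  Continuous π ∧ Function.Surjective π ∧ ∀ x, π (F x) = f (π x)

/-- A map is u-resolving if it is injective on unstable sets. -/
def UResolving {X Y : Type*} [MetricSpace X] (F : Equiv.Perm X) (π : X → Y) : Prop :=
  ∀ x : X, Set.InjOn π (unstableSet F x)

/-- A map is s-resolving if it is injective on stable sets. -/
def SResolving {X Y : Type*} [MetricSpace X] (F : Equiv.Perm X) (π : X → Y) : Prop :=
  ∀ x : X, Set.InjOn π (stableSet F x)

/-- The shift map on bi-infinite sequences. -/
def shiftE (A : Type*) : Equiv.Perm (ℤ → A) where
  toFun x i := x (i + 1)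
  invFun x i := x (i - 1)
  left_inv x := funext fun i => congrArg x (by ring)
  right_inv x := funext fun i => congrArg x (by ring)

/-- The word `w` occurs in the sequence `x`. -/
def OccursIn {A : Type*} {k : ℕ} (w : Fin k → A) (x : ℤ → A) : Prop :=
  ∃ i : ℤ, ∀ j : Fin k, x (i + (j : ℤ)) = w j

/-- A subshift of finite type: the sequences avoiding a finite set of forbidden words. -/
def IsSFT {A : Type*} (S : Set (ℤ → A)) : Prop :=
  ∃ Fw : Set ((k : ℕ) × (Fin k → A)), Fw.Finite ∧
    S = {x | ∀ w ∈ Fw, ¬ OccursIn w.2 x}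

/-- A one-step SFT (vertex shift) with transition rule `T`. -/
def IsOneStepSFTFor {A : Type*} (T : A → A → Prop) (S : Set (ℤ → A)) : Prop :=
  S = {x | ∀ i : ℤ, T (x i) (x (i + 1))}

/-- `S` is invariant under the shift and its inverse. -/
def ShiftInvariant {A : Type*} (S : Set (ℤ → A)) : Prop :=
  (∀ x ∈ S, shiftE A x ∈ S) ∧ (∀ x ∈ S, (shiftE A).symm x ∈ S)

/-- A factor map from the subshift `(S, σ)` onto the system `(Y, f)`. -/
def IsSubshiftFactorMap {A Y : Type*} [TopologicalSpace A] [MetricSpace Y]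
    (S : Set (ℤ → A)) (f : Equiv.Perm Y) (φ : (ℤ → A) → Y) : Prop :=
  ContinuousOn φ S ∧ φ '' S = Set.univ ∧ ∀ x ∈ S, φ (shiftE A x) = f (φ x)

/-- Topological transitivity of the shift restricted to `S`. -/
def SubshiftTransitive {A : Type*} [TopologicalSpace A] (S : Set (ℤ → A)) : Prop :=
  ∀ U V : Set (ℤ → A), IsOpen U → IsOpen V → (U ∩ S).Nonempty → (V ∩ S).Nonempty →
    ∃ n : ℕ, (((shiftE A) ^ (n : ℤ)) ⁻¹' U ∩ V ∩ S).Nonempty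

/-- The stable set of `t` in the subshift `S`: points eventually agreeing with `t`. -/
def shiftStable {A : Type*} (S : Set (ℤ → A)) (t : ℤ → A) : Set (ℤ → A) :=
  {t' ∈ S | ∃ N : ℤ, ∀ i ≥ N, t' i = t i}

/-- A finitely presented system: an expansive system that is a factor of an SFT. -/
def FinitelyPresented {Y : Type*} [MetricSpace Y] (f : Equiv.Perm Y) : Prop :=
  Continuous (⇑f) ∧ Continuous (⇑f.symm) ∧ (∃ c > 0, Expansive f c) ∧
  ∃ (N : ℕ) (S : Set (ℤ → Fin N)), IsSFT S ∧ ShiftInvariant S ∧ S.Nonempty ∧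
    ∃ φ : (ℤ → Fin N) → Y, IsSubshiftFactorMap S f φ

section QuotMetr

variable {Z : Type} [TopologicalSpace Z] [CompactSpace Z] [T2Space Z]

theorem quot_isClosedMap (r : Setoid Z) (hr : IsClosed {p : Z × Z | r.r p.1 p.2}) :
    IsClosedMap (Quotient.mk r) := by
  intro C hC
  rw [← isQuotientMap_quotient_mk'.isClosed_preimage]
  have : Quotient.mk r ⁻¹' (Quotient.mk r '' C) =
      Prod.snd '' ({p : Z × Z | r.r p.1 p.2} ∩ (Prod.fst ⁻¹' C)) := by
    ext z
    simp only [mem_preimage, mem_image, mem_inter_iff, Prod.exists]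
    constructor
    · rintro ⟨c, hc, h⟩
      exact ⟨c, z, ⟨Quotient.exact h, hc⟩, rfl⟩
    · rintro ⟨c, z', ⟨h, hc⟩, rfl⟩
      exact ⟨c, hc, Quotient.sound h⟩
  change IsClosed (Quotient.mk r ⁻¹' _)
  rw [this]
  exact ((hr.inter (hC.preimage continuous_fst)).isCompact.image continuous_snd).isClosed

/-- kernel image -/
theorem quot_kernel_open (r : Setoid Z) (hr : IsClosed {p : Z × Z | r.r p.1 p.2})
    (U : Set Z) (hU : IsOpen U) : IsOpen {q : Quotient r | Quotient.mk r ⁻¹' {q} ⊆ U} := by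
  have := (quot_isClosedMap r hr _ hU.isClosed_compl).isOpen_compl
  convert this using 1
  ext q
  simp only [mem_compl_iff, mem_image, not_exists, not_and]
  constructor
  · intro h x hx hq; exact hx (h hq)
  · intro h x hx; by_contra hc; exact h x hc hx

theorem quot_fiber_compact (r : Setoid Z) (hr : IsClosed {p : Z × Z | r.r p.1 p.2})
    (q : Quotient r) : IsCompact (Quotient.mk r ⁻¹' {q}) := by
  obtain ⟨z, rfl⟩ := Quotient.exists_rep q
  have h1 : IsClosed ({(Quotient.mk r z)} : Set (Quotient r)) := by
    have := quot_isClosedMap r hr {z} isClosed_singleton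
    simpa using this
  exact (h1.preimage continuous_quotient_mk').isCompact

theorem quot_t2 (r : Setoid Z) (hr : IsClosed {p : Z × Z | r.r p.1 p.2}) :
    T2Space (Quotient r) := by
  refine ⟨fun x y hxy => ?_⟩
  have hd : Disjoint (Quotient.mk r ⁻¹' {x}) (Quotient.mk r ⁻¹' {y}) := by
    rw [Set.disjoint_left]; rintro z rfl h; exact hxy h
  obtain ⟨U, V, hU, hV, hxU, hyV, hUV⟩ :=
    SeparatedNhds.of_isCompact_isCompact (quot_fiber_compact r hr x) (quot_fiber_compact r hr y) hd
  refine ⟨_, _, quot_kernel_open r hr U hU, quot_kernel_open r hr V hV, hxU, hyV, ?_⟩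
  rw [Set.disjoint_left]
  intro q h1 h2
  obtain ⟨z, rfl⟩ := Quotient.exists_rep q
  exact Set.disjoint_left.1 hUV (h1 rfl) (h2 rfl)

theorem quot_second_countable [SecondCountableTopology Z] (r : Setoid Z)
    (hr : IsClosed {p : Z × Z | r.r p.1 p.2}) :
    SecondCountableTopology (Quotient r) := by
  obtain ⟨B, hBc, -, hB⟩ := TopologicalSpace.exists_countable_basis Z
  have hcount : {s : Set (Set Z) | s.Finite ∧ s ⊆ B}.Countable := by
    exact Set.countable_ofPred_finite_subset hBc
  have hb : TopologicalSpace.IsTopologicalBasis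
      ((fun s : Set (Set Z) => {q : Quotient r | Quotient.mk r ⁻¹' {q} ⊆ ⋃₀ s}) ''
        {s : Set (Set Z) | s.Finite ∧ s ⊆ B}) := by
    apply TopologicalSpace.isTopologicalBasis_of_isOpen_of_nhds
    · rintro _ ⟨s, ⟨hs, hsB⟩, rfl⟩
      exact quot_kernel_open r hr _ (isOpen_sUnion fun u hu => hB.isOpen (hsB hu))
    · intro q W hq hW
      have hK := quot_fiber_compact r hr q
      have hWo : IsOpen (Quotient.mk r ⁻¹' W) := hW.preimage continuous_quotient_mk'
      obtain ⟨t, htS, htf, hcov⟩ := hK.elim_finite_subcover_image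
        (b := {u | u ∈ B ∧ u ⊆ Quotient.mk r ⁻¹' W}) (c := id)
        (fun u hu => hB.isOpen hu.1) (by
          intro z hz
          have hzW : z ∈ Quotient.mk r ⁻¹' W := by
            have : Quotient.mk r z = q := hz
            simpa [this] using hq
          obtain ⟨u, hu, hzu, huW⟩ := hB.exists_subset_of_mem_open hzW hWo
          exact mem_biUnion (show u ∈ _ from ⟨hu, huW⟩) hzu)
      refine ⟨_, ⟨t, ⟨htf, fun u hu => (htS hu).1⟩, rfl⟩, ?_, ?_⟩
      · intro z hz
        have := hcov hz
        simp only [mem_iUnion, id] at this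
        obtain ⟨u, hu, hzu⟩ := this
        exact ⟨u, hu, hzu⟩
      · intro q' hq'
        obtain ⟨z, rfl⟩ := Quotient.exists_rep q'
        obtain ⟨u, hu, hzu⟩ := hq' (show z ∈ _ from rfl)
        exact (htS hu).2 hzu
  exact hb.secondCountableTopology (hcount.image _)

theorem quot_metrizable [SecondCountableTopology Z] (r : Setoid Z)
    (hr : IsClosed {p : Z × Z | r.r p.1 p.2}) :
    TopologicalSpace.MetrizableSpace (Quotient r) := by
  have := quot_t2 r hr
  have := quot_second_countable r hr
  infer_instance

end QuotMetr

theorem semiconj_zpow {Z W : Type} (σ : Equiv.Perm Z) (g : Equiv.Perm W) (pr : Z → W)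
    (h : ∀ z, pr (σ z) = g (pr z)) (i : ℤ) (z : Z) : pr ((σ ^ i) z) = (g ^ i) (pr z) := by
  have hinv : ∀ z, pr (σ⁻¹ z) = g⁻¹ (pr z) := by
    intro z
    rw [Equiv.Perm.eq_inv_iff_eq, ← h]; simp
  induction i using Int.induction_on generalizing z with
  | zero => simp
  | succ n ih => rw [zpow_add_one, zpow_add_one, Equiv.Perm.mul_apply, Equiv.Perm.mul_apply, ih, h]
  | pred n ih => rw [zpow_sub_one, zpow_sub_one, Equiv.Perm.mul_apply, Equiv.Perm.mul_apply, ih, hinv]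

theorem continuous_zpow_perm {Z : Type} [TopologicalSpace Z] (σ : Equiv.Perm Z)
    (h1 : Continuous σ) (h2 : Continuous σ.symm) (i : ℤ) : Continuous (σ ^ i : Equiv.Perm Z) := by
  induction i using Int.induction_on with
  | zero => exact continuous_id
  | succ n ih => rw [zpow_add_one]; exact ih.comp h1
  | pred n ih => rw [zpow_sub_one]; exact ih.comp h2

theorem zpow_add_perm {Z : Type} (σ : Equiv.Perm Z) (i j : ℤ) (z : Z) :
    (σ ^ i) ((σ ^ j) z) = (σ ^ (i + j)) z := by
  rw [zpow_add]; rfl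

section Smale

variable {Z W : Type} [TopologicalSpace Z] [CompactSpace Z] [MetricSpace W]
  (σ : Equiv.Perm Z) (V : Z → Z → Prop) (pr : Z → W) (g : Equiv.Perm W)

/-- open sets containing the kernel contain all close pairs -/
theorem close_of_open (hpr : Continuous pr) (O : Set (Z × Z)) (hO : IsOpen O)
    (hker : ∀ z z', pr z = pr z' → (z, z') ∈ O) :
    ∃ δ > 0, ∀ z z', dist (pr z) (pr z') < δ → (z, z') ∈ O := by
  have hcont : Continuous (fun p : Z × Z => dist (pr p.1) (pr p.2)) := by fun_prop
  rcases (Oᶜ).eq_empty_or_nonempty with he | hne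
  · refine ⟨1, one_pos, fun z z' _ => ?_⟩
    rw [compl_empty_iff] at he; rw [he]; trivial
  · obtain ⟨p, hp, hmin⟩ := hO.isClosed_compl.isCompact.exists_isMinOn hne hcont.continuousOn
    refine ⟨dist (pr p.1) (pr p.2), ?_, ?_⟩
    · rw [gt_iff_lt, dist_pos]; intro h; exact hp (hker _ _ h)
    · intro z z' h
      by_contra hc
      exact absurd (hmin hc) (not_le.2 h)

theorem isClopen_Vi
    (hσ : Continuous σ) (hσ' : Continuous σ.symm) (hV : IsClopen {p : Z × Z | V p.1 p.2})
    (i : ℤ) : IsClopen {p : Z × Z | V ((σ ^ i) p.1) ((σ ^ i) p.2)} := by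
  have hc := continuous_zpow_perm σ hσ hσ' i
  exact hV.preimage (f := fun p : Z × Z => ((σ ^ i) p.1, (σ ^ i) p.2)) (by fun_prop)

theorem isClopen_Vn
    (hσ : Continuous σ) (hσ' : Continuous σ.symm) (hV : IsClopen {p : Z × Z | V p.1 p.2})
    (n : ℕ) : IsClopen
    {p : Z × Z | ∀ i : ℤ, -(n : ℤ) ≤ i → i ≤ n → V ((σ ^ i) p.1) ((σ ^ i) p.2)} := by
  have : {p : Z × Z | ∀ i : ℤ, -(n : ℤ) ≤ i → i ≤ n → V ((σ ^ i) p.1) ((σ ^ i) p.2)} =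
      ⋂ i ∈ Set.Icc (-(n : ℤ)) n, {p : Z × Z | V ((σ ^ i) p.1) ((σ ^ i) p.2)} := by
    ext p; simp
  rw [this]
  exact (Set.finite_Icc _ _).isClopen_biInter (fun i _ => isClopen_Vi σ V hσ hσ' hV i)

theorem V_of_close
    (hV : IsClopen {p : Z × Z | V p.1 p.2}) (hpr : Continuous pr) (hker : ∀ z z', pr z = pr z' ↔ ∀ i : ℤ, V ((σ ^ i) z) ((σ ^ i) z'))
    : ∃ c > 0, ∀ z z', dist (pr z) (pr z') < c → V z z' := by
  refine close_of_open pr hpr _ hV.isOpen ?_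
  intro z z' h
  exact (hker z z').1 h 0

theorem Vn_of_close
    (hσ : Continuous σ) (hσ' : Continuous σ.symm) (hV : IsClopen {p : Z × Z | V p.1 p.2}) (hpr : Continuous pr) (hker : ∀ z z', pr z = pr z' ↔ ∀ i : ℤ, V ((σ ^ i) z) ((σ ^ i) z'))
    (n : ℕ) : ∃ δ > 0, ∀ z z', dist (pr z) (pr z') < δ →
    ∀ i : ℤ, -(n : ℤ) ≤ i → i ≤ n → V ((σ ^ i) z) ((σ ^ i) z') := by
  refine close_of_open pr hpr _ (isClopen_Vn σ V hσ hσ' hV n).isOpen ?_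
  intro z z' h i _ _
  exact (hker z z').1 h i

theorem close_of_Vn
    (hσ : Continuous σ) (hσ' : Continuous σ.symm) (hV : IsClopen {p : Z × Z | V p.1 p.2}) (hpr : Continuous pr) (hker : ∀ z z', pr z = pr z' ↔ ∀ i : ℤ, V ((σ ^ i) z) ((σ ^ i) z'))
    (ε : ℝ) (hε : 0 < ε) : ∃ n : ℕ, ∀ z z',
    (∀ i : ℤ, -(n : ℤ) ≤ i → i ≤ n → V ((σ ^ i) z) ((σ ^ i) z')) → dist (pr z) (pr z') < ε := by
  have hcont : Continuous (fun p : Z × Z => dist (pr p.1) (pr p.2)) := by fun_prop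
  by_contra hcon
  push Not at hcon
  let K : ℕ → Set (Z × Z) := fun n =>
    {p : Z × Z | ∀ i : ℤ, -(n : ℤ) ≤ i → i ≤ n → V ((σ ^ i) p.1) ((σ ^ i) p.2)} ∩
      {p | ε ≤ dist (pr p.1) (pr p.2)}
  have hKc : ∀ n, IsClosed (K n) := fun n =>
    (isClopen_Vn σ V hσ hσ' hV n).isClosed.inter (isClosed_le continuous_const hcont)
  obtain ⟨p, hp⟩ := IsCompact.nonempty_iInter_of_sequence_nonempty_isCompact_isClosed K
    (fun n p hp => ⟨fun i h1 h2 => hp.1 i (by push_cast; omega) (by push_cast; omega), hp.2⟩)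
    (fun n => by
      obtain ⟨z, z', h, h'⟩ := hcon n
      exact ⟨(z, z'), h, h'⟩)
    (hKc 0).isCompact hKc
  rw [mem_iInter] at hp
  have h0 := (hp 0).2
  have : pr p.1 = pr p.2 := by
    rw [hker]
    intro i
    exact (hp i.natAbs).1 i (by omega) (by omega)
  simp only [mem_ofPred_eq, this, dist_self] at h0
  linarith

theorem asym_neg
    (hV : IsClopen {p : Z × Z | V p.1 p.2}) (hpr : Continuous pr) (hker : ∀ z z', pr z = pr z' ↔ ∀ i : ℤ, V ((σ ^ i) z) ((σ ^ i) z')) (hg : ∀ z, pr (σ z) = g (pr z))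
    (z z' : Z) (h : Tendsto (fun n : ℕ => dist ((g ^ (-(n : ℤ))) (pr z))
    ((g ^ (-(n : ℤ))) (pr z'))) atTop (𝓝 0)) :
    ∃ i₀ : ℤ, ∀ i ≤ i₀, V ((σ ^ i) z) ((σ ^ i) z') := by
  obtain ⟨c, hc, hcV⟩ := V_of_close σ V pr hV hpr hker
  obtain ⟨N, hN⟩ := eventually_atTop.1 (h.eventually (gt_mem_nhds hc))
  refine ⟨-(N : ℤ), fun i hi => hcV _ _ ?_⟩
  rw [semiconj_zpow σ g pr hg, semiconj_zpow σ g pr hg]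
  have := hN i.natAbs (by omega)
  rwa [show -(i.natAbs : ℤ) = i by omega] at this

theorem asym_pos
    (hV : IsClopen {p : Z × Z | V p.1 p.2}) (hpr : Continuous pr) (hker : ∀ z z', pr z = pr z' ↔ ∀ i : ℤ, V ((σ ^ i) z) ((σ ^ i) z')) (hg : ∀ z, pr (σ z) = g (pr z))
    (z z' : Z) (h : Tendsto (fun n : ℕ => dist ((g ^ ((n : ℤ))) (pr z))
    ((g ^ ((n : ℤ))) (pr z'))) atTop (𝓝 0)) :
    ∃ i₀ : ℤ, ∀ i ≥ i₀, V ((σ ^ i) z) ((σ ^ i) z') := by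
  obtain ⟨c, hc, hcV⟩ := V_of_close σ V pr hV hpr hker
  obtain ⟨N, hN⟩ := eventually_atTop.1 (h.eventually (gt_mem_nhds hc))
  refine ⟨(N : ℤ), fun i hi => hcV _ _ ?_⟩
  rw [semiconj_zpow σ g pr hg, semiconj_zpow σ g pr hg]
  have := hN i.natAbs (by omega)
  rwa [show (i.natAbs : ℤ) = i by omega] at this

theorem smale_of_cover
    (hσ : Continuous σ) (hσ' : Continuous σ.symm) (hV : IsClopen {p : Z × Z | V p.1 p.2}) (hpr : Continuous pr) (hker : ∀ z z', pr z = pr z' ↔ ∀ i : ℤ, V ((σ ^ i) z) ((σ ^ i) z')) (hg : ∀ z, pr (σ z) = g (pr z))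
    (hsurj : Function.Surjective pr)
    (hbr : ∀ n : ℕ, ∃ m : ℕ, ∀ z z',
      (∀ i : ℤ, -(m : ℤ) ≤ i → i ≤ m → V ((σ ^ i) z) ((σ ^ i) z')) →
      ∃ z'', (∀ i : ℤ, -(n : ℤ) ≤ i → V ((σ ^ i) z) ((σ ^ i) z'')) ∧
        (∀ i : ℤ, i ≤ n → V ((σ ^ i) z') ((σ ^ i) z''))) : IsSmale g := by
  have hq : IsQuotientMap pr := IsQuotientMap.of_surjective_continuous hsurj hpr
  obtain ⟨c, hc, hcV⟩ := V_of_close σ V pr hV hpr hker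
  have hexp : ∀ p q : W, (∀ n : ℤ, dist ((g ^ n) p) ((g ^ n) q) < c) → p = q := by
    intro p q h
    obtain ⟨z, rfl⟩ := hsurj p
    obtain ⟨z', rfl⟩ := hsurj q
    rw [hker]
    intro i
    apply hcV
    rw [semiconj_zpow σ g pr hg, semiconj_zpow σ g pr hg]
    exact h i
  refine ⟨?_, ?_, ⟨c / 2, by positivity, ?_⟩, ⟨c / 2, by positivity, ?_⟩⟩
  · rw [hq.continuous_iff]
    have : g ∘ pr = pr ∘ σ := funext fun z => (hg z).symm
    rw [this]; exact hpr.comp hσ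
  · rw [hq.continuous_iff]
    have : g.symm ∘ pr = pr ∘ σ.symm := funext fun z => by
      simp only [Function.comp]
      rw [Equiv.symm_apply_eq, ← hg]; simp
    rw [this]; exact hpr.comp hσ'
  · intro p q hpq
    by_contra hcon
    push Not at hcon
    exact hpq (hexp p q fun n => (hcon n).trans_lt (by linarith))
  · intro ε hε hεc
    obtain ⟨n, hn⟩ := close_of_Vn σ V pr hσ hσ' hV hpr hker ε hε
    obtain ⟨m, hm⟩ := hbr n
    obtain ⟨δ, hδ, hδV⟩ := Vn_of_close σ V pr hσ hσ' hV hpr hker m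
    refine ⟨δ, hδ, fun x y hxy => ?_⟩
    obtain ⟨z, rfl⟩ := hsurj x
    obtain ⟨z', rfl⟩ := hsurj y
    obtain ⟨z'', h1, h2⟩ := hm z z' (hδV z z' hxy)
    refine ⟨pr z'', ⟨?_, ?_⟩, ?_⟩
    · intro k
      rw [← semiconj_zpow σ g pr hg, ← semiconj_zpow σ g pr hg]
      apply hn
      intro i hi1 hi2
      rw [zpow_add_perm, zpow_add_perm]
      exact h1 _ (by omega)
    · intro k
      rw [← semiconj_zpow σ g pr hg, ← semiconj_zpow σ g pr hg]
      apply hn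
      intro i hi1 hi2
      rw [zpow_add_perm, zpow_add_perm]
      exact h2 _ (by omega)
    · have key : ∀ w1 w2 : W, w1 ∈ Ws g ε (pr z) ∩ Wu g ε (pr z') →
          w2 ∈ Ws g ε (pr z) ∩ Wu g ε (pr z') → w1 = w2 := by
        intro w1 w2 hw1 hw2
        apply hexp
        intro k
        rcases le_total 0 k with hk | hk
        · have e1 := hw1.1 k.natAbs
          have e2 := hw2.1 k.natAbs
          rw [show (k.natAbs : ℤ) = k by omega] at e1 e2
          rw [dist_comm] at e1
          exact (dist_triangle _ _ _).trans_lt (by linarith)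
        · have e1 := hw1.2 k.natAbs
          have e2 := hw2.2 k.natAbs
          rw [show -(k.natAbs : ℤ) = k by omega] at e1 e2
          rw [dist_comm] at e1
          exact (dist_triangle _ _ _).trans_lt (by linarith)
      intro w hw
      refine key w _ hw ⟨?_, ?_⟩
      · intro k
        rw [← semiconj_zpow σ g pr hg, ← semiconj_zpow σ g pr hg]
        apply hn
        intro i hi1 hi2
        rw [zpow_add_perm, zpow_add_perm]
        exact h1 _ (by omega)
      · intro k
        rw [← semiconj_zpow σ g pr hg, ← semiconj_zpow σ g pr hg]
        apply hn
        intro i hi1 hi2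
        rw [zpow_add_perm, zpow_add_perm]
        exact h2 _ (by omega)

end Smale

theorem exists_quotient_system {Z : Type} [TopologicalSpace Z] [CompactSpace Z] [T2Space Z]
    [SecondCountableTopology Z] (σ : Equiv.Perm Z) (hσ : Continuous σ) (hσ' : Continuous σ.symm)
    (V : Z → Z → Prop) (hV : IsClopen {p : Z × Z | V p.1 p.2})
    (heq : Equivalence (fun z z' => ∀ i : ℤ, V ((σ ^ i) z) ((σ ^ i) z'))) :
    ∃ (W : Type) (_ : MetricSpace W) (_ : CompactSpace W) (g : Equiv.Perm W) (pr : Z → W),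
      Continuous pr ∧ Function.Surjective pr ∧
      (∀ z z', pr z = pr z' ↔ ∀ i : ℤ, V ((σ ^ i) z) ((σ ^ i) z')) ∧
      ∀ z, pr (σ z) = g (pr z) := by
  let r : Setoid Z := ⟨_, heq⟩
  have hr : IsClosed {p : Z × Z | r.r p.1 p.2} := by
    have : {p : Z × Z | r.r p.1 p.2} =
        ⋂ i : ℤ, {p : Z × Z | V ((σ ^ i) p.1) ((σ ^ i) p.2)} := by
      ext p; rw [mem_iInter]; exact Iff.rfl
    rw [this]
    exact isClosed_iInter fun i => (isClopen_Vi σ V hσ hσ' hV i).isClosed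
  have hm := quot_metrizable r hr
  have hs : ∀ z z', r.r z z' → r.r (σ z) (σ z') := by
    intro z z' h i
    have := h (i + 1)
    rwa [zpow_add_one] at this
  have hs' : ∀ z z', r.r z z' → r.r (σ.symm z) (σ.symm z') := by
    intro z z' h i
    have := h (i - 1)
    rwa [zpow_sub_one] at this
  let g : Equiv.Perm (Quotient r) :=
    { toFun := Quotient.map σ hs
      invFun := Quotient.map σ.symm hs'
      left_inv := by rintro ⟨z⟩; exact congrArg (Quotient.mk r) (σ.symm_apply_apply z)
      right_inv := by rintro ⟨z⟩; exact congrArg (Quotient.mk r) (σ.apply_symm_apply z) }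
  have hc : CompactSpace (Quotient r) := inferInstance
  refine ⟨Quotient r, TopologicalSpace.metrizableSpaceMetric _, hc, g, Quotient.mk r,
    continuous_quotient_mk', Quotient.mk_surjective, ?_, fun z => rfl⟩
  intro z z'
  exact Quotient.eq

/-- A predicate on sequences depending on finitely many coordinates is clopen. -/
theorem isClopen_of_local {B : Type} [TopologicalSpace B] [DiscreteTopology B]
    (P : (ℤ → B) → Prop) (s : Set ℤ) (hs : s.Finite)
    (h : ∀ z z', (∀ j ∈ s, z j = z' j) → P z → P z') : IsClopen {z | P z} := by
  have key : ∀ (P : (ℤ → B) → Prop), (∀ z z', (∀ j ∈ s, z j = z' j) → P z → P z') →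
      IsOpen {z | P z} := by
    intro P h
    rw [isOpen_iff_mem_nhds]
    intro z hz
    have ho : IsOpen (⋂ j ∈ s, (fun w : ℤ → B => w j) ⁻¹' {z j}) :=
      hs.isOpen_biInter fun j _ => (isOpen_discrete _).preimage (continuous_apply j)
    refine mem_of_superset (ho.mem_nhds (by simp)) ?_
    intro w hw
    simp only [mem_iInter, mem_preimage, mem_singleton_iff] at hw
    exact h z w (fun j hj => (hw j hj).symm) hz
  refine ⟨?_, key P h⟩
  have : {z | P z} = {z | ¬ P z}ᶜ := by ext z; simp
  rw [this]
  exact (key (fun z => ¬ P z) fun z z' hz hp hp' => hp (h z' z (fun j hj => (hz j hj).symm) hp')).isClosed_compl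

/-- bi-infinite paths -/
def Path' {A : Type} (T : A → A → Prop) (t : ℤ → A) : Prop := ∀ i, T (t i) (t (i + 1))

/-- left part of u, right part of v -/
noncomputable def splice {A : Type} (i : ℤ) (u v : ℤ → A) : ℤ → A := fun j => if j ≤ i then u j else v j

theorem splice_le {A : Type} {i j : ℤ} {u v : ℤ → A} (h : j ≤ i) : splice i u v j = u j := if_pos h

theorem splice_ge {A : Type} {i j : ℤ} {u v : ℤ → A} (huv : u i = v i) (h : i ≤ j) :
    splice i u v j = v j := by
  unfold splice
  split_ifs with h1
  · have : j = i := le_antisymm h1 h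
    rw [this, huv]
  · rfl

theorem splice_gt {A : Type} {i j : ℤ} {u v : ℤ → A} (h : i < j) :
    splice i u v j = v j := if_neg (not_le.2 h)

theorem path_splice' {A : Type} {T : A → A → Prop} {u v : ℤ → A} {i : ℤ}
    (hu : ∀ j < i, T (u j) (u (j + 1))) (hv : ∀ j ≥ i, T (v j) (v (j + 1))) (huv : u i = v i) :
    Path' T (splice i u v) := by
  intro j
  rcases lt_or_ge j i with h | h
  · rw [splice_le h.le, splice_le (by omega)]; exact hu j h
  · rw [splice_ge huv h, splice_ge huv (by omega)]; exact hv j h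

theorem path_splice {A : Type} {T : A → A → Prop} {u v : ℤ → A} {i : ℤ}
    (hu : Path' T u) (hv : Path' T v) (huv : u i = v i) : Path' T (splice i u v) :=
  path_splice' (fun j _ => hu j) (fun j _ => hv j) huv

theorem path_splice_gt {A : Type} {T : A → A → Prop} {u v : ℤ → A} {i : ℤ}
    (hu : Path' T u) (hv : Path' T v) (huv : T (u i) (v (i + 1))) : Path' T (splice i u v) := by
  intro j
  rcases lt_trichotomy j i with h | h | h
  · rw [splice_le h.le, splice_le (by omega)]; exact hu j
  · subst h; rw [splice_le le_rfl, splice_gt (by omega)]; exact huv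
  · rw [splice_gt h, splice_gt (by omega)]; exact hv j

theorem path_shift {A : Type} {T : A → A → Prop} {u : ℤ → A} (hu : Path' T u) (k : ℤ) :
    Path' T (fun j => u (j + k)) := by
  intro j
  have := hu (j + k)
  rwa [show j + k + 1 = j + 1 + k by ring] at this

def Comp2 {A : Type} (R : A → A → Prop) (a c : A) : Prop := ∃ b, R a b ∧ R b c

structure Core {A : Type} (T R Q : A → A → Prop) (M : ℕ) : Prop where
  ess : ∀ a, ∃ t, Path' T t ∧ t 0 = a
  Rr : ∀ a, R a a
  Rs : ∀ a b, R a b → R b a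
  Qr : ∀ a, Q a a
  Qs : ∀ a b, Q a b → Q b a
  R3 : ∀ u v, Path' T u → Path' T v → ∀ i : ℤ, (∀ j ≤ i + M, Comp2 R (u j) (v j)) →
    ∀ j ≤ i, R (u j) (v j)
  Q3 : ∀ u v, Path' T u → Path' T v → ∀ i : ℤ, (∀ j ≤ i + M, Comp2 Q (u j) (v j)) →
    ∀ j ≤ i, Q (u j) (v j)
  ND : ∀ u v, Path' T u → Path' T v → ∀ k l : ℤ, (∀ j ≤ k, u j = v j) → (∀ j ≥ l, u j = v j) →
    (∀ j, Comp2 R (u j) (v j)) → u = v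

@[ext]
structure Sym' (A : Type) where
  t : A
  E : A → A → Prop

instance (A : Type) : TopologicalSpace (Sym' A) := ⊥
instance (A : Type) : DiscreteTopology (Sym' A) := ⟨rfl⟩
instance (A : Type) [Finite A] : Finite (Sym' A) :=
  Finite.of_injective (fun s : Sym' A => (s.t, s.E)) (by
    rintro ⟨a, b⟩ ⟨c, d⟩ h; simpa using h)

section core
variable {A : Type} (T R Q : A → A → Prop) (M : ℕ)

def Bad (b d : A) : Prop := b ≠ d ∧ ∃ w w', Path' T w ∧ Path' T w' ∧ w 0 = b ∧ w' 0 = d ∧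
  (∃ l : ℤ, ∀ j ≥ l, w j = w' j) ∧ ∀ j ≥ 0, Comp2 R (w j) (w' j)

structure ZAt (z : ℤ → Sym' A) (i : ℤ) : Prop where
  z0 : T (z i).t (z (i + 1)).t
  z1 : (z i).E (z i).t (z i).t
  z2 : ∀ c c', (z (i + 1)).E c c' ↔ Q c c' ∧ R c (z (i + 1)).t ∧ R c' (z (i + 1)).t ∧
    ∃ b b', (z i).E b b' ∧ T b c ∧ T b' c'
  z3 : ∀ b b', (z i).E b b' → (z i).E b' b ∧ (z i).E b b
  z4 : ∀ b d, (z i).E b b → (z i).E d d → ¬ Bad T R b d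
  z5 : ∀ u u' u'', Path' T u → Path' T u' → Path' T u'' →
    (∀ j, i ≤ j → j ≤ i + M → (z j).E (u j) (u' j) ∧ (z j).E (u' j) (u'' j)) →
    (z i).E (u i) (u'' i)

def IsZ (z : ℤ → Sym' A) : Prop := ∀ i, ZAt T R Q M z i

def InL (z : ℤ → Sym' A) (i : ℤ) (u u' : ℤ → A) : Prop := ∀ j ≤ i, (z j).E (u j) (u' j)
def Lam (z : ℤ → Sym' A) (u u' : ℤ → A) : Prop := ∃ i, InL z i u u'

variable {T R Q M}

theorem Core.ess_at (hC : Core T R Q M) (a : A) (i : ℤ) : ∃ t, Path' T t ∧ t i = a := by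
  obtain ⟨t, ht, h0⟩ := hC.ess a
  exact ⟨_, path_shift ht (-i), by simpa using h0⟩

theorem Core.c2 (hC : Core T R Q M) {a b : A} (h : R a b) : Comp2 R a b := ⟨b, h, hC.Rr b⟩
theorem Core.c2r (hC : Core T R Q M) (a : A) : Comp2 R a a := hC.c2 (hC.Rr a)

theorem Core.R3' (hC : Core T R Q M) {u v : ℤ → A} (hu : Path' T u) (hv : Path' T v)
    (h : ∀ j, Comp2 R (u j) (v j)) (j : ℤ) : R (u j) (v j) :=
  hC.R3 u v hu hv j (fun k _ => h k) j le_rfl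

theorem ZAt_local (i : ℤ) (z z' : ℤ → Sym' A)
    (h : ∀ j ∈ Set.Icc i (i + M + 1), z j = z' j) (hz : ZAt T R Q M z i) : ZAt T R Q M z' i := by
  have e0 : z i = z' i := h i ⟨by omega, by omega⟩
  have e1 : z (i + 1) = z' (i + 1) := h (i + 1) ⟨by omega, by omega⟩
  obtain ⟨a0, a1, a2, a3, a4, a5⟩ := hz
  rw [e0] at a0 a1 a3 a4 a2
  rw [e1] at a0 a2
  refine ⟨a0, a1, a2, a3, a4, ?_⟩
  intro u u' u'' hu hu' hu'' hh
  rw [← e0]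
  refine a5 u u' u'' hu hu' hu'' fun j h1 h2 => ?_
  rw [h j ⟨h1, by omega⟩]; exact hh j h1 h2

theorem isClopen_ZAt (i : ℤ) : IsClopen {z : ℤ → Sym' A | ZAt T R Q M z i} :=
  isClopen_of_local _ (Set.Icc i (i + M + 1)) (Set.finite_Icc _ _) (ZAt_local i)

theorem IsZ.path {z : ℤ → Sym' A} (hz : IsZ T R Q M z) : Path' T (fun i => (z i).t) :=
  fun i => (hz i).z0

theorem IsZ.zz {z : ℤ → Sym' A} (hz : IsZ T R Q M z) (i : ℤ) (c c' : A) :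
    (z i).E c c' ↔ Q c c' ∧ R c (z i).t ∧ R c' (z i).t ∧
    ∃ b b', (z (i - 1)).E b b' ∧ T b c ∧ T b' c' := by
  have := (hz (i - 1)).z2 c c'
  rwa [show i - 1 + 1 = i by ring] at this

theorem IsZ.sym {z : ℤ → Sym' A} (hz : IsZ T R Q M z) {i : ℤ} {c c' : A} (h : (z i).E c c') :
    (z i).E c' c := ((hz i).z3 _ _ h).1
theorem IsZ.dl {z : ℤ → Sym' A} (hz : IsZ T R Q M z) {i : ℤ} {c c' : A} (h : (z i).E c c') :
    (z i).E c c := ((hz i).z3 _ _ h).2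
theorem IsZ.dr {z : ℤ → Sym' A} (hz : IsZ T R Q M z) {i : ℤ} {c c' : A} (h : (z i).E c c') :
    (z i).E c' c' := hz.dl (hz.sym h)
theorem IsZ.eQ {z : ℤ → Sym' A} (hz : IsZ T R Q M z) {i : ℤ} {c c' : A} (h : (z i).E c c') :
    Q c c' := ((hz.zz i c c').1 h).1
theorem IsZ.eR {z : ℤ → Sym' A} (hz : IsZ T R Q M z) {i : ℤ} {c c' : A} (h : (z i).E c c') :
    R c (z i).t := ((hz.zz i c c').1 h).2.1
theorem IsZ.eR' {z : ℤ → Sym' A} (hz : IsZ T R Q M z) {i : ℤ} {c c' : A} (h : (z i).E c c') :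
    R c' (z i).t := ((hz.zz i c c').1 h).2.2.1

theorem IsZ.e2 (hC : Core T R Q M) {z : ℤ → Sym' A} (hz : IsZ T R Q M z) {i : ℤ} {c d : A}
    (h : (z i).E c c) (h' : (z i).E d d) : Comp2 R c d :=
  ⟨_, hz.eR h, hC.Rs _ _ (hz.eR h')⟩

/-- backward choice -/
theorem back_path {α : Type} (G : ℤ → α → Prop) (S : α → α → Prop)
    (h : ∀ j c, G j c → ∃ b, G (j - 1) b ∧ S b c) (i : ℤ) (c : α) (hc : G i c) :
    ∃ w : ℤ → α, w i = c ∧ (∀ j ≤ i, G j (w j)) ∧ ∀ j < i, S (w j) (w (j + 1)) := by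
  choose! pb hpb using h
  let f : ℕ → α := fun n => Nat.rec c (fun n a => pb (i - n) a) n
  have hf0 : f 0 = c := rfl
  have hfs : ∀ n, f (n + 1) = pb (i - n) (f n) := fun n => rfl
  have hG : ∀ n : ℕ, G (i - n) (f n) := by
    intro n
    induction n with
    | zero => simpa [hf0] using hc
    | succ n ih =>
      rw [hfs]
      have := (hpb _ _ ih).1
      rwa [show i - (n : ℤ) - 1 = i - ((n + 1 : ℕ) : ℤ) by push_cast; ring] at this
  refine ⟨fun j => f (i - j).toNat, by simp [hf0], ?_, ?_⟩
  · intro j hj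
    have := hG (i - j).toNat
    rwa [show i - ((i - j).toNat : ℤ) = j by omega] at this
  · intro j hj
    have := (hpb _ _ (hG (i - (j + 1)).toNat)).2
    rw [← hfs] at this
    rwa [show (i - (j + 1)).toNat + 1 = (i - j).toNat by omega] at this

theorem anc_glue {z : ℤ → Sym' A} (hz : IsZ T R Q M z) {i k : ℤ} (hik : i ≤ k)
    {u u' : ℤ → A} (hu : Path' T u) (hu' : Path' T u')
    (h : ∀ j, i ≤ j → j ≤ k → (z j).E (u j) (u' j)) :
    ∃ w w', Path' T w ∧ Path' T w' ∧ (∀ j ≥ i, w j = u j) ∧ (∀ j ≥ i, w' j = u' j) ∧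
      InL z k w w' := by
  obtain ⟨p, hpi, hpG, hpS⟩ := back_path (fun j (c : A × A) => (z j).E c.1 c.2)
    (fun b c => T b.1 c.1 ∧ T b.2 c.2) (by
      intro j c hc
      obtain ⟨-, -, -, b, b', h1, h2, h3⟩ := (hz.zz j _ _).1 hc
      exact ⟨(b, b'), h1, h2, h3⟩) i (u i, u' i) (h i le_rfl hik)
  have e1 : (fun j => (p j).1) i = u i := by simp [hpi]
  have e2 : (fun j => (p j).2) i = u' i := by simp [hpi]
  refine ⟨splice i (fun j => (p j).1) u, splice i (fun j => (p j).2) u', ?_, ?_, ?_, ?_, ?_⟩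
  · exact path_splice' (fun j hj => (hpS j hj).1) (fun j _ => hu j) e1
  · exact path_splice' (fun j hj => (hpS j hj).2) (fun j _ => hu' j) e2
  · intro j hj; exact splice_ge e1 hj
  · intro j hj; exact splice_ge e2 hj
  · intro j hj
    rcases le_total j i with hji | hji
    · rw [splice_le hji, splice_le hji]; exact hpG j hji
    · rw [splice_ge e1 hji, splice_ge e2 hji]; exact h j hji hj

/-- uniqueness of pasts -/
theorem up_lam (hC : Core T R Q M) {z : ℤ → Sym' A} (hz : IsZ T R Q M z) {u v : ℤ → A}
    (hu : Path' T u) (hv : Path' T v) {i : ℤ} (hui : (z i).E (u i) (u i)) (hvi : (z i).E (v i) (v i))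
    (hR : ∀ j ≥ i, Comp2 R (u j) (v j)) (l : ℤ) (hl : ∀ j ≥ l, u j = v j) : u i = v i := by
  by_contra hne
  refine (hz i).z4 _ _ hui hvi ⟨hne, _, _, path_shift hu i, path_shift hv i, by simp, by simp,
    ⟨l - i, fun j hj => hl _ (by omega)⟩, fun j hj => hR _ (by omega)⟩

theorem up_path (hC : Core T R Q M) {z : ℤ → Sym' A} (hz : IsZ T R Q M z) {u v : ℤ → A}
    (hu : Path' T u) (hv : Path' T v) {i k : ℤ} (hik : i ≤ k)
    (h1 : ∀ j, i ≤ j → j ≤ k → (z j).E (u j) (u j)) (h2 : ∀ j, i ≤ j → j ≤ k → (z j).E (v j) (v j))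
    (hk : u k = v k) : u i = v i := by
  have := up_lam hC hz hu (path_splice hv hu hk.symm) (i := i) (h1 i le_rfl hik)
    (by rw [splice_le hik]; exact h2 i le_rfl hik) (by
      intro j hj
      rcases le_total j k with hjk | hjk
      · rw [splice_le hjk]; exact hz.e2 hC (h1 j hj hjk) (h2 j hj hjk)
      · rw [splice_ge hk.symm hjk]; exact hC.c2r _) k (by
      intro j hj; rw [splice_ge hk.symm hj])
  rwa [splice_le hik] at this

theorem rec_in {z : ℤ → Sym' A} (hz : IsZ T R Q M z) {u u' : ℤ → A}
    (hu : Path' T u) (hu' : Path' T u') {k i : ℤ} (hk : InL z k u u')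
    (h : ∀ j, k < j → j ≤ i → Q (u j) (u' j) ∧ R (u j) (z j).t ∧ R (u' j) (z j).t) :
    InL z i u u' := by
  have key : ∀ n : ℕ, k + n ≤ i → InL z (k + n) u u' := by
    intro n
    induction n with
    | zero => intro _; simpa using hk
    | succ n ih =>
      intro hn j hj
      have ih' := ih (by push_cast at hn; omega)
      rcases le_or_gt j (k + n) with hj' | hj'
      · exact ih' j hj'
      · have hj2 : j = k + n + 1 := by push_cast at hj; omega
        obtain ⟨q1, q2, q3⟩ := h j (by omega) (by push_cast at hn; omega)
        refine (hz.zz j _ _).2 ⟨q1, q2, q3, u (j - 1), u' (j - 1), ih' _ (by omega), ?_, ?_⟩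
        · have := hu (j - 1); rwa [show j - 1 + 1 = j by ring] at this
        · have := hu' (j - 1); rwa [show j - 1 + 1 = j by ring] at this
  rcases le_or_gt k i with hki | hki
  · have := key (i - k).toNat (by omega)
    rwa [show k + ((i - k).toNat : ℤ) = i by omega] at this
  · intro j hj; exact hk j (by omega)

end core

section core2
variable {A : Type} {T R Q : A → A → Prop} {M : ℕ}

def Egen (T R Q : A → A → Prop) (L : (ℤ → A) → (ℤ → A) → Prop) (t : ℤ → A) (i : ℤ) (c c' : A) : Prop :=
  ∃ u u', Path' T u ∧ Path' T u' ∧ L u u' ∧ u i = c ∧ u' i = c' ∧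
    ∀ j ≤ i, R (u j) (t j) ∧ R (u' j) (t j) ∧ Q (u j) (u' j)

theorem lift_ZAt (hC : Core T R Q M) {t : ℤ → A} (ht : Path' T t)
    (L : (ℤ → A) → (ℤ → A) → Prop) (i : ℤ) (Lt : L t t)
    (L1 : ∀ u u' w w', L u u' → (∀ j ≤ i, w j = u j) → (∀ j ≤ i, w' j = u' j) → L w w')
    (Ls : ∀ u u', Path' T u → Path' T u' → L u u' → L u' u ∧ L u u)
    (L2 : ∀ u v, Path' T u → Path' T v → L u u → L v v → (∀ j, Comp2 R (u j) (v j)) →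
      (∃ l : ℤ, ∀ j ≥ l, u j = v j) → u = v)
    (L3 : ∀ u u' u'', Path' T u → Path' T u' → Path' T u'' → L u u' → L u' u'' → L u u'') :
    ZAt T R Q M (fun j => ⟨t j, Egen T R Q L t j⟩) i := by
  refine ⟨ht i, ?_, ?_, ?_, ?_, ?_⟩
  · exact ⟨t, t, ht, ht, Lt, rfl, rfl, fun j _ => ⟨hC.Rr _, hC.Rr _, hC.Qr _⟩⟩
  · intro c c'
    constructor
    · rintro ⟨u, u', hu, hu', hL, rfl, rfl, h⟩
      obtain ⟨h1, h2, h3⟩ := h (i + 1) le_rfl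
      exact ⟨h3, h1, h2, u i, u' i, ⟨u, u', hu, hu', hL, rfl, rfl, fun j hj => h j (by omega)⟩,
        hu i, hu' i⟩
    · rintro ⟨hq, hr, hr', b, b', ⟨u, u', hu, hu', hL, rfl, rfl, h⟩, hT, hT'⟩
      obtain ⟨v, hv, hvc⟩ := hC.ess_at c (i + 1)
      obtain ⟨v', hv', hvc'⟩ := hC.ess_at c' (i + 1)
      refine ⟨splice i u v, splice i u' v', path_splice_gt hu hv (hvc ▸ hT),
        path_splice_gt hu' hv' (hvc' ▸ hT'), L1 _ _ _ _ hL (fun j hj => splice_le hj)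
        (fun j hj => splice_le hj), ?_, ?_, ?_⟩
      · rw [splice_gt (by omega), hvc]
      · rw [splice_gt (by omega), hvc']
      · intro j hj
        rcases le_or_gt j i with hji | hji
        · rw [splice_le hji, splice_le hji]; exact h j hji
        · have : j = i + 1 := by omega
          subst this
          rw [splice_gt hji, splice_gt hji, hvc, hvc']
          exact ⟨hr, hr', hq⟩
  · rintro b b' ⟨u, u', hu, hu', hL, rfl, rfl, h⟩
    refine ⟨⟨u', u, hu', hu, (Ls _ _ hu hu' hL).1, rfl, rfl, fun j hj => ?_⟩,
      ⟨u, u, hu, hu, (Ls _ _ hu hu' hL).2, rfl, rfl, fun j hj => ?_⟩⟩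
    · obtain ⟨h1, h2, h3⟩ := h j hj
      exact ⟨h2, h1, hC.Qs _ _ h3⟩
    · obtain ⟨h1, h2, h3⟩ := h j hj
      exact ⟨h1, h1, hC.Qr _⟩
  · rintro b d ⟨u, u', hu, hu', hL, hub, hub', h⟩ ⟨v, v', hv, hv', hLv, hvd, hvd', h'⟩
      ⟨hne, w, w', hw, hw', hw0, hw0', ⟨l, hl⟩, hR⟩
    have hLu := (Ls _ _ hu hu' hL).2
    have hLv := (Ls _ _ hv hv' hLv).2
    have e1 : u i = (fun j => w (j + (-i))) i := by simp [hub, hw0]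
    have e2 : v i = (fun j => w' (j + (-i))) i := by simp [hvd, hw0']
    have := L2 (splice i u (fun j => w (j + (-i)))) (splice i v (fun j => w' (j + (-i))))
      (path_splice hu (path_shift hw _) e1) (path_splice hv (path_shift hw' _) e2)
      (L1 _ _ _ _ hLu (fun j hj => splice_le hj) (fun j hj => splice_le hj))
      (L1 _ _ _ _ hLv (fun j hj => splice_le hj) (fun j hj => splice_le hj)) (by
        intro j
        rcases le_total j i with hj | hj
        · rw [splice_le hj, splice_le hj]
          exact ⟨_, (h j hj).1, hC.Rs _ _ (h' j hj).1⟩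
        · rw [splice_ge e1 hj, splice_ge e2 hj]
          exact hR _ (by omega))
      ⟨max i (l + i), fun j hj => by
        have hj1 : i ≤ j := (le_max_left _ _).trans hj
        have hj2 : l + i ≤ j := (le_max_right _ _).trans hj
        rw [splice_ge e1 hj1, splice_ge e2 hj1]
        exact hl _ (by omega)⟩
    have := congrFun this i
    rw [splice_le le_rfl, splice_le le_rfl, hub, hvd] at this
    exact hne this
  · intro u u' u'' hu hu' hu'' h
    -- glue
    have glue : ∀ u u', Path' T u → Path' T u' →
        (∀ j, i ≤ j → j ≤ i + M → Egen T R Q L t j (u j) (u' j)) →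
        ∃ y y', Path' T y ∧ Path' T y' ∧ L y y' ∧ (∀ j ≥ i, y j = u j) ∧ (∀ j ≥ i, y' j = u' j) ∧
          ∀ j ≤ i + M, R (y j) (t j) ∧ R (y' j) (t j) ∧ Q (y j) (y' j) := by
      intro u u' hu hu' h
      obtain ⟨x, x', hx, hx', hL, e, e', hh⟩ := h i le_rfl (by omega)
      refine ⟨splice i x u, splice i x' u', path_splice hx hu e, path_splice hx' hu' e',
        L1 _ _ _ _ hL (fun j hj => splice_le hj) (fun j hj => splice_le hj),
        fun j hj => splice_ge e hj, fun j hj => splice_ge e' hj, ?_⟩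
      intro j hj
      rcases le_total j i with hji | hji
      · rw [splice_le hji, splice_le hji]; exact hh j hji
      · rw [splice_ge e hji, splice_ge e' hji]
        obtain ⟨a, a', -, -, -, e3, e4, hh⟩ := h j hji hj
        have := hh j le_rfl
        rwa [e3, e4] at this
    obtain ⟨y, y1, hy, hy1, hL1, f1, f2, g1⟩ := glue u u' hu hu' (fun j h1 h2 => (h j h1 h2).1)
    obtain ⟨y2, y3, hy2, hy3, hL2, f3, f4, g2⟩ := glue u' u'' hu' hu'' (fun j h1 h2 => (h j h1 h2).2)
    have e12 : y1 = y2 := by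
      apply L2 y1 y2 hy1 hy2 (Ls _ _ hy1 hy (Ls _ _ hy hy1 hL1).1).2 (Ls _ _ hy2 hy3 hL2).2
      · intro j
        rcases le_total j i with hji | hji
        · exact ⟨_, (g1 j (by omega)).2.1, hC.Rs _ _ (g2 j (by omega)).1⟩
        · rw [f2 j hji, f3 j hji]; exact hC.c2r _
      · exact ⟨i, fun j hj => by rw [f2 j hj, f3 j hj]⟩
    subst e12
    have hQ : ∀ j ≤ i, Q (y j) (y3 j) := hC.Q3 y y3 hy hy3 i
      (fun j hj => ⟨_, (g1 j hj).2.2, (g2 j hj).2.2⟩)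
    exact ⟨y, y3, hy, hy3, L3 _ _ _ hy hy1 hy3 hL1 hL2, f1 i le_rfl, f4 i le_rfl,
      fun j hj => ⟨(g1 j (by omega)).1, (g2 j (by omega)).2.1, hQ j hj⟩⟩

/-- every path lifts to Z -/
theorem exists_lift [Finite A] (hC : Core T R Q M) {t : ℤ → A} (ht : Path' T t) :
    ∃ z, IsZ T R Q M z ∧ ∀ i, (z i).t = t i := by
  let K : ℕ → Set (ℤ → Sym' A) := fun n =>
    (⋂ i ∈ Set.Ici (-(n : ℤ)), {z | ZAt T R Q M z i}) ∩ ⋂ i : ℤ, {z | (z i).t = t i}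
  have hKc : ∀ n, IsClosed (K n) := by
    intro n
    refine IsClosed.inter (isClosed_biInter fun i _ => (isClopen_ZAt i).isClosed)
      (isClosed_iInter fun i => ?_)
    refine (isClopen_of_local _ {i} (Set.finite_singleton i) ?_).isClosed
    intro z z' h hz
    rw [← h i rfl]; exact hz
  obtain ⟨z, hz⟩ := IsCompact.nonempty_iInter_of_sequence_nonempty_isCompact_isClosed K
    (fun n z hz => by
      refine ⟨?_, hz.2⟩
      have := hz.1
      simp only [mem_iInter] at this ⊢
      intro i hi
      exact this i (by simp only [mem_Ici] at hi ⊢; push_cast; omega))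
    (fun n => by
      refine ⟨fun j => ⟨t j, Egen T R Q
        (fun u u' => ∀ j ≤ -(n : ℤ), u j = t j ∧ u' j = t j) t j⟩, ?_, ?_⟩
      · simp only [mem_iInter]
        intro i hi
        simp only [mem_Ici] at hi
        refine lift_ZAt hC ht _ i (fun j _ => ⟨rfl, rfl⟩) ?_ ?_ ?_ ?_
        · intro u u' w w' h h1 h2 j hj
          rw [h1 j (by omega), h2 j (by omega)]; exact h j hj
        · intro u u' _ _ h
          exact ⟨fun j hj => (h j hj).symm, fun j hj => ⟨(h j hj).1, (h j hj).1⟩⟩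
        · rintro u v hu hv h h' hR ⟨l, hl⟩
          exact hC.ND u v hu hv (-n) l (fun j hj => by rw [(h j hj).1, (h' j hj).1]) hl hR
        · intro u u' u'' _ _ _ h h' j hj
          exact ⟨(h j hj).1, (h' j hj).2⟩
      · simp only [mem_iInter]; intro i; rfl)
    (hKc 0).isCompact hKc
  rw [mem_iInter] at hz
  refine ⟨z, fun i => ?_, fun i => ?_⟩
  · have := (hz i.natAbs).1
    simp only [mem_iInter] at this
    exact this i (by simp only [mem_Ici]; omega)
  · have := (hz 0).2
    simp only [mem_iInter] at this
    exact this i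

theorem rebase (hC : Core T R Q M) {z : ℤ → Sym' A} (hz : IsZ T R Q M z) {t : ℤ → A}
    (ht : Path' T t) (htL : Lam z t t) :
    ∃ z', IsZ T R Q M z' ∧ (∀ i, (z' i).t = t i) ∧
      ∀ u u', Path' T u → Path' T u' → (Lam z' u u' ↔ Lam z u u') := by
  have L1 : ∀ i, ∀ u u' w w', Lam z u u' → (∀ j ≤ i, w j = u j) → (∀ j ≤ i, w' j = u' j) →
      Lam z w w' := by
    rintro i u u' w w' ⟨k, hk⟩ h1 h2
    refine ⟨min i k, fun j hj => ?_⟩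
    rw [h1 j (hj.trans (min_le_left _ _)), h2 j (hj.trans (min_le_left _ _))]
    exact hk j (hj.trans (min_le_right _ _))
  have hZ : IsZ T R Q M (fun j => ⟨t j, Egen T R Q (Lam z) t j⟩) := by
    intro i
    refine lift_ZAt hC ht _ i htL (L1 i) ?_ ?_ ?_
    · rintro u u' _ _ ⟨k, hk⟩
      exact ⟨⟨k, fun j hj => hz.sym (hk j hj)⟩, ⟨k, fun j hj => hz.dl (hk j hj)⟩⟩
    · rintro u v hu hv ⟨k, hk⟩ ⟨k', hk'⟩ hR ⟨l, hl⟩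
      refine hC.ND u v hu hv (min k k') l (fun j hj => ?_) hl hR
      exact up_lam hC hz hu hv (hk j (hj.trans (min_le_left _ _)))
        (hk' j (hj.trans (min_le_right _ _))) (fun j _ => hR j) l hl
    · rintro u u' u'' hu hu' hu'' ⟨k, hk⟩ ⟨k', hk'⟩
      refine ⟨min k k' - M, fun j hj => (hz j).z5 u u' u'' hu hu' hu'' fun i h1 h2 => ?_⟩
      exact ⟨hk i (by have := min_le_left k k'; omega), hk' i (by have := min_le_right k k'; omega)⟩
  refine ⟨_, hZ, fun i => rfl, fun u u' hu hu' => ⟨?_, ?_⟩⟩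
  · rintro ⟨k, hk⟩
    obtain ⟨w, w', hw, hw', hL, e, e', h⟩ := hk k le_rfl
    have hkw : InL (fun j => ⟨t j, Egen T R Q (Lam z) t j⟩) k w w' := fun j hj =>
      ⟨w, w', hw, hw', hL, rfl, rfl, fun i hi => h i (hi.trans hj)⟩
    refine L1 k w w' u u' hL ?_ ?_
    · intro j hj
      exact up_path hC hZ hu hw hj (fun i _ hi => hZ.dl (hk i hi)) (fun i _ hi => hZ.dl (hkw i hi)) e.symm
    · intro j hj
      exact up_path hC hZ hu' hw' hj (fun i _ hi => hZ.dr (hk i hi)) (fun i _ hi => hZ.dr (hkw i hi)) e'.symm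
  · rintro ⟨k, hk⟩
    obtain ⟨k', hk'⟩ := htL
    have a1 := min_le_left k k'
    have a2 := min_le_right k k'
    have r1 := hC.R3 u t hu ht (min k k' - M) (fun j hj =>
      ⟨_, hz.eR (hk j (by omega)), hC.Rs _ _ (hz.eR (hk' j (by omega)))⟩)
    have r2 := hC.R3 u' t hu' ht (min k k' - M) (fun j hj =>
      ⟨_, hz.eR' (hk j (by omega)), hC.Rs _ _ (hz.eR (hk' j (by omega)))⟩)
    refine ⟨min k k' - M, fun j hj => ⟨u, u', hu, hu', ⟨k, hk⟩, rfl, rfl, fun i hi => ?_⟩⟩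
    exact ⟨r1 i (by omega), r2 i (by omega), hz.eQ (hk i (by omega))⟩

def Vh (T : A → A → Prop) (M : ℕ) (z z' : ℤ → Sym' A) (i : ℤ) : Prop :=
  ∀ u u', Path' T u → Path' T u' → (∀ j, i ≤ j → j ≤ i + M → (z j).E (u j) (u' j)) →
    (z' i).E (u i) (u' i)

def VAt (T : A → A → Prop) (M : ℕ) (b : Prop) (z z' : ℤ → Sym' A) (i : ℤ) : Prop :=
  Vh T M z z' i ∧ Vh T M z' z i ∧ (b → (z i).E (z i).t (z' i).t)

theorem Vh_of_lam (hC : Core T R Q M) {z z' : ℤ → Sym' A} (hz : IsZ T R Q M z)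
    (hz' : IsZ T R Q M z') (hL : ∀ u u', Path' T u → Path' T u' → Lam z u u' → Lam z' u u')
    {i : ℤ} (hR : ∀ j ≤ i + M, R (z j).t (z' j).t) : Vh T M z z' i := by
  intro u u' hu hu' h
  obtain ⟨w, w', hw, hw', e, e', hI⟩ := anc_glue hz (by omega) hu hu' h
  obtain ⟨k, hk⟩ := hL w w' hw hw' ⟨_, hI⟩
  have r1 := hC.R3 w _ hw hz'.path i (fun j hj => ⟨_, hz.eR (hI j hj), hR j hj⟩)
  have r2 := hC.R3 w' _ hw' hz'.path i (fun j hj => ⟨_, hz.eR' (hI j hj), hR j hj⟩)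
  have := rec_in hz' hw hw' (k := k) (i := i) hk
    (fun j _ hj => ⟨hz.eQ (hI j (by omega)), r1 j hj, r2 j hj⟩) i le_rfl
  rwa [e i le_rfl, e' i le_rfl] at this

theorem lam_of_Vh {z z' : ℤ → Sym' A} {i₀ : ℤ} (h : ∀ i ≤ i₀, Vh T M z z' i) {u u' : ℤ → A}
    (hu : Path' T u) (hu' : Path' T u') (hL : Lam z u u') : Lam z' u u' := by
  obtain ⟨k, hk⟩ := hL
  have a1 := min_le_left i₀ (k - M)
  have a2 := min_le_right i₀ (k - M)
  exact ⟨min i₀ (k - M), fun j hj => h j (by omega) u u' hu hu' fun l _ h2 => hk l (by omega)⟩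

theorem Vh_t {z z' : ℤ → Sym' A} (hz : IsZ T R Q M z) {i : ℤ} (h : Vh T M z z' i) :
    (z' i).E (z i).t (z i).t := h _ _ hz.path hz.path fun j _ _ => (hz j).z1

theorem Vh_R {z z' : ℤ → Sym' A} (hz : IsZ T R Q M z) (hz' : IsZ T R Q M z') {i : ℤ}
    (h : Vh T M z z' i) : R (z i).t (z' i).t := hz'.eR (Vh_t hz h)

def LamEq (T : A → A → Prop) (z z' : ℤ → Sym' A) : Prop :=
  ∀ u u', Path' T u → Path' T u' → (Lam z u u' ↔ Lam z' u u')

theorem lamEq_of_V {z z' : ℤ → Sym' A} {b : Prop} {i₀ : ℤ} (h : ∀ i ≤ i₀, VAt T M b z z' i) :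
    LamEq T z z' := fun _ _ hu hu' =>
  ⟨lam_of_Vh (fun i hi => (h i hi).1) hu hu', lam_of_Vh (fun i hi => (h i hi).2.1) hu hu'⟩

theorem allV_of (hC : Core T R Q M) {z z' : ℤ → Sym' A} (hz : IsZ T R Q M z)
    (hz' : IsZ T R Q M z') {b : Prop} (hL : LamEq T z z') (hR : ∀ j, R (z j).t (z' j).t)
    (hb : b → ∀ i, (z i).E (z i).t (z' i).t) (i : ℤ) : VAt T M b z z' i :=
  ⟨Vh_of_lam hC hz hz' (fun u u' hu hu' => (hL u u' hu hu').1) fun j _ => hR j,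
   Vh_of_lam hC hz' hz (fun u u' hu hu' => (hL u u' hu hu').2) fun j _ => hC.Rs _ _ (hR j),
   fun h => hb h i⟩

theorem V_refl (hC : Core T R Q M) {z : ℤ → Sym' A} (hz : IsZ T R Q M z) (b : Prop) (i : ℤ) :
    VAt T M b z z i :=
  allV_of hC hz hz (fun _ _ _ _ => Iff.rfl) (fun _ => hC.Rr _) (fun _ i => (hz i).z1) i

theorem V_symm {z z' : ℤ → Sym' A} (hz : IsZ T R Q M z) (hz' : IsZ T R Q M z') (b : Prop)
    (h : ∀ i, VAt T M b z z' i) (i : ℤ) : VAt T M b z' z i := by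
  refine ⟨(h i).2.1, (h i).1, fun hb => ?_⟩
  exact hz'.sym ((h i).1 _ _ hz.path hz'.path fun j _ _ => (h j).2.2 hb)

theorem V_trans (hC : Core T R Q M) {z z' z'' : ℤ → Sym' A} (hz : IsZ T R Q M z)
    (hz' : IsZ T R Q M z') (hz'' : IsZ T R Q M z'') (b : Prop)
    (h : ∀ i, VAt T M b z z' i) (h' : ∀ i, VAt T M b z' z'' i) (i : ℤ) : VAt T M b z z'' i := by
  have e1 := lamEq_of_V (i₀ := 0) fun i _ => h i
  have e2 := lamEq_of_V (i₀ := 0) fun i _ => h' i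
  refine allV_of hC hz hz'' (fun u u' hu hu' => (e1 u u' hu hu').trans (e2 u u' hu hu')) ?_ ?_ i
  · exact fun j => hC.R3' hz.path hz''.path
      (fun k => ⟨_, Vh_R hz hz' (h k).1, Vh_R hz' hz'' (h' k).1⟩) j
  · intro hb i
    refine (hz i).z5 _ _ _ hz.path hz'.path hz''.path fun j _ _ => ⟨(h j).2.2 hb, ?_⟩
    exact (h j).2.1 _ _ hz'.path hz''.path fun l _ _ => (h' l).2.2 hb

theorem bracket (hC : Core T R Q M) {b : Prop} {z z' : ℤ → Sym' A} (hz : IsZ T R Q M z)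
    (hz' : IsZ T R Q M z') (n m : ℤ) (hn : 0 ≤ n) (hm : m = n + 2 * M)
    (hV : ∀ i, -m ≤ i → i ≤ m → VAt T M b z z' i) :
    ∃ z'', IsZ T R Q M z'' ∧ (∀ i, -n ≤ i → VAt T M b z z'' i) ∧
      (∀ i ≤ n, VAt T M b z' z'' i) := by
  obtain ⟨v, v', hv, -, hvt, -, hvI⟩ := anc_glue hz' (i := -m) (k := m) (by omega) hz.path hz.path
    (fun j h1 h2 => Vh_t hz (hV j h1 h2).1)
  have hvI : InL z' m v v := fun j hj => hz'.dl (hvI j hj)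
  obtain ⟨z'', hz'', ht'', hL⟩ := rebase hC hz' hv ⟨m, hvI⟩
  have hRv : ∀ j ≤ m, R (v j) (z' j).t := fun j hj => hz'.eR (hvI j hj)
  have hE0 : ∀ c c', (z (-n)).E c c' ↔ (z'' (-n)).E c c' := by
    intro c c'
    obtain ⟨p, hp, hpc⟩ := hC.ess_at c (-n)
    obtain ⟨p', hp', hpc'⟩ := hC.ess_at c' (-n)
    constructor
    · intro h
      obtain ⟨w, w', hw, hw', e, e', hI⟩ := anc_glue hz (i := -n) (k := -n) le_rfl hp hp'
        (fun j h1 h2 => by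
          have : j = -n := le_antisymm h2 h1
          subst this; rw [hpc, hpc']; exact h)
      have hE' := (hV (-m) le_rfl (by omega)).1 w w' hw hw' fun j _ h2 => hI j (by omega)
      obtain ⟨x, x', hx, hx', f, f', hIx⟩ := anc_glue hz' (i := -m) (k := -m) le_rfl hw hw'
        (fun j h1 h2 => by
          have : j = -m := le_antisymm h2 h1
          subst this; exact hE')
      obtain ⟨k, hk⟩ := (hL x x' hx hx').2 ⟨_, hIx⟩
      have hr0 : ∀ j, -m ≤ j → j ≤ -n → R (x j) (v j) ∧ R (x' j) (v j) := fun j h1 h2 => by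
        rw [f j h1, f' j h1, hvt j h1]
        exact ⟨hz.eR (hI j h2), hz.eR' (hI j h2)⟩
      have r1 := hC.R3 x v hx hv (-n - M) (fun j hj => by
        rcases le_total j (-m) with hjm | hjm
        · exact ⟨_, hz'.eR (hIx j hjm), hC.Rs _ _ (hRv j (by omega))⟩
        · exact hC.c2 (hr0 j hjm (by omega)).1)
      have r2 := hC.R3 x' v hx' hv (-n - M) (fun j hj => by
        rcases le_total j (-m) with hjm | hjm
        · exact ⟨_, hz'.eR' (hIx j hjm), hC.Rs _ _ (hRv j (by omega))⟩
        · exact hC.c2 (hr0 j hjm (by omega)).2)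
      have := rec_in hz'' hx hx' (k := k) (i := -n) hk (fun j _ hj => by
        rw [ht'']
        rcases le_total j (-m) with hjm | hjm
        · exact ⟨hz'.eQ (hIx j hjm), r1 j (by omega), r2 j (by omega)⟩
        · refine ⟨?_, (hr0 j hjm hj).1, (hr0 j hjm hj).2⟩
          rw [f j hjm, f' j hjm]; exact hz.eQ (hI j hj)) (-n) le_rfl
      rwa [f _ (by omega), f' _ (by omega), e _ le_rfl, e' _ le_rfl, hpc, hpc'] at this
    · intro h
      obtain ⟨w, w', hw, hw', e, e', hI⟩ := anc_glue hz'' (i := -n) (k := -n) le_rfl hp hp'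
        (fun j h1 h2 => by
          have : j = -n := le_antisymm h2 h1
          subst this; rw [hpc, hpc']; exact h)
      obtain ⟨k, hk⟩ := (hL w w' hw hw').1 ⟨_, hI⟩
      have hwR : ∀ j ≤ -n, R (w j) (v j) ∧ R (w' j) (v j) := fun j hj => by
        have h1 := hz''.eR (hI j hj)
        have h2 := hz''.eR' (hI j hj)
        rw [ht''] at h1 h2
        exact ⟨h1, h2⟩
      have r1 := hC.R3 w _ hw hz'.path (-n - M) (fun j hj =>
        ⟨_, (hwR j (by omega)).1, hRv j (by omega)⟩)
      have r2 := hC.R3 w' _ hw' hz'.path (-n - M) (fun j hj =>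
        ⟨_, (hwR j (by omega)).2, hRv j (by omega)⟩)
      have hI' := rec_in hz' hw hw' (k := k) (i := -n - M) hk (fun j _ hj =>
        ⟨hz''.eQ (hI j (by omega)), r1 j hj, r2 j hj⟩)
      have hE := (hV (-m) le_rfl (by omega)).2.1 w w' hw hw' fun j _ h2 => hI' j (by omega)
      obtain ⟨x, x', hx, hx', f, f', hIx⟩ := anc_glue hz (i := -m) (k := -m) le_rfl hw hw'
        (fun j h1 h2 => by
          have : j = -m := le_antisymm h2 h1
          subst this; exact hE)
      have := rec_in hz hx hx' (k := -m) (i := -n) hIx (fun j h1 hj => by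
        rw [f j h1.le, f' j h1.le]
        have := hvt j h1.le
        have h3 := hwR j hj
        rw [this] at h3
        exact ⟨hz''.eQ (hI j hj), h3.1, h3.2⟩) (-n) le_rfl
      rwa [f _ (by omega), f' _ (by omega), e _ le_rfl, e' _ le_rfl, hpc, hpc'] at this
  have htt : ∀ i, -m ≤ i → (z'' i).t = (z i).t := fun i hi => by rw [ht'', hvt i hi]
  have hEn : ∀ k : ℕ, ∀ c c', (z (-n + k)).E c c' ↔ (z'' (-n + k)).E c c' := by
    intro k
    induction k with
    | zero => simpa using hE0
    | succ k ih =>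
      intro c c'
      rw [hz.zz, hz''.zz, htt _ (by push_cast; omega),
        show -n + ((k + 1 : ℕ) : ℤ) - 1 = -n + k by push_cast; ring]
      simp only [ih]
  have hE : ∀ i, -n ≤ i → ∀ c c', (z i).E c c' ↔ (z'' i).E c c' := by
    intro i hi
    have := hEn (i + n).toNat
    rwa [show -n + ((i + n).toNat : ℤ) = i by omega] at this
  refine ⟨z'', hz'', ?_, ?_⟩
  · intro i hi
    refine ⟨fun u u' _ _ h => ?_, fun u u' _ _ h => ?_, fun _ => ?_⟩
    · exact (hE i hi _ _).1 (h i le_rfl (by omega))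
    · exact (hE i hi _ _).2 (h i le_rfl (by omega))
    · rw [htt i (by omega)]; exact (hz i).z1
  · intro i hi
    refine ⟨Vh_of_lam hC hz' hz'' (fun u u' hu hu' => (hL u u' hu hu').2) ?_,
      Vh_of_lam hC hz'' hz' (fun u u' hu hu' => (hL u u' hu hu').1) ?_, fun hb => ?_⟩
    · intro j hj
      rw [ht'']; exact hC.Rs _ _ (hRv j (by omega))
    · intro j hj
      rw [ht'']; exact hRv j (by omega)
    · obtain ⟨w, w', hw, hw', e, e', hI⟩ := anc_glue hz' (i := -m) (k := m - M) (by omega)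
        hz.path hz'.path (fun j h1 h2 => (hV j h1 (by omega)).1 _ _ hz.path hz'.path
          fun l h3 h4 => (hV l (by omega) (by omega)).2.2 hb)
      have q1 : w i = v i := up_path hC hz' hw hv (k := max i (-m)) (le_max_left _ _)
        (fun j _ hj => hz'.dl (hI j (by omega))) (fun j _ hj => hvI j (by omega))
        (by rw [e _ (le_max_right _ _), hvt _ (le_max_right _ _)])
      have q2 : w' i = (z' i).t := up_path hC hz' hw' hz'.path (k := max i (-m)) (le_max_left _ _)
        (fun j _ hj => hz'.dr (hI j (by omega))) (fun j _ hj => (hz' j).z1)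
        (e' _ (le_max_right _ _))
      have := hz'.sym (hI i (by omega))
      rwa [q1, q2, ← ht''] at this

end core2

theorem factor_exists {Z W X : Type} [TopologicalSpace Z] [CompactSpace Z] [TopologicalSpace W]
    [T2Space W] [TopologicalSpace X] (pr : Z → W) (hpr : Continuous pr)
    (hs : Function.Surjective pr) (h : Z → X) (hc : Continuous h)
    (hk : ∀ z z', pr z = pr z' → h z = h z') :
    ∃ φ : W → X, Continuous φ ∧ ∀ z, φ (pr z) = h z := by
  have hq : IsQuotientMap pr := IsQuotientMap.of_surjective_continuous hs hpr
  have e : ∀ z, h (Function.surjInv hs (pr z)) = h z := fun z => hk _ _ (Function.surjInv_eq hs _)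
  refine ⟨fun w => h (Function.surjInv hs w), ?_, e⟩
  rw [hq.continuous_iff]
  have : (fun w => h (Function.surjInv hs w)) ∘ pr = h := funext e
  rw [this]; exact hc

section core3
variable {A : Type} {T R Q : A → A → Prop} {M : ℕ}

theorem core_ures (hC : Core T R Q M) {b : Prop} {z z' : ℤ → Sym' A} (hz : IsZ T R Q M z)
    (hz' : IsZ T R Q M z') {i₀ : ℤ} (h : ∀ i ≤ i₀, VAt T M b z z' i)
    (hR : ∀ j, R (z j).t (z' j).t) (hQ : b → ∀ j, Q (z j).t (z' j).t) (i : ℤ) :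
    VAt T M b z z' i := by
  refine allV_of hC hz hz' (lamEq_of_V h) hR ?_ i
  intro hb i
  exact rec_in hz hz.path hz'.path (k := i₀) (i := i) (fun j hj => (h j hj).2.2 hb)
    (fun j _ _ => ⟨hQ hb j, hC.Rr _, hC.Rs _ _ (hR j)⟩) i le_rfl

theorem core_sres (hC : Core T R Q M) {z z' : ℤ → Sym' A} (hz : IsZ T R Q M z)
    (hz' : IsZ T R Q M z') {i₀ : ℤ} (h : ∀ i ≥ i₀, VAt T M True z z' i)
    (h' : ∀ i, VAt T M False z z' i) (i : ℤ) :
    VAt T M True z z' i := by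
  refine ⟨(h' i).1, (h' i).2.1, fun _ => ?_⟩
  rcases le_total i₀ i with hi | hi
  · exact (h i hi).2.2 trivial
  obtain ⟨w, w', hw, hw', e, e', hI⟩ := anc_glue hz (i := i₀) (k := i₀) le_rfl hz.path hz'.path
    (fun j h1 _ => (h j h1).2.2 trivial)
  have q1 : w i = (z i).t := up_path hC hz hw hz.path hi (fun j _ hj => hz.dl (hI j hj))
    (fun j _ _ => (hz j).z1) (e _ le_rfl)
  have q2 : w' i = (z' i).t := up_path hC hz hw' hz'.path hi (fun j _ hj => hz.dr (hI j hj))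
    (fun j _ _ => Vh_t hz' (h' j).2.1) (e' _ le_rfl)
  have := hI i hi
  rwa [q1, q2] at this

theorem ZAt_shift {z : ℤ → Sym' A} {i k : ℤ} (h : ZAt T R Q M z (i + k)) :
    ZAt T R Q M (fun j => z (j + k)) i := by
  obtain ⟨a0, a1, a2, a3, a4, a5⟩ := h
  have e : i + k + 1 = i + 1 + k := by ring
  rw [e] at a0 a2
  refine ⟨a0, a1, a2, a3, a4, ?_⟩
  intro u u' u'' hu hu' hu'' h
  have := a5 _ _ _ (path_shift hu (-k)) (path_shift hu' (-k)) (path_shift hu'' (-k))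
    (fun j h1 h2 => by
      have := h (j + -k) (by omega) (by omega)
      simpa using this)
  simpa using this

theorem IsZ_shift {z : ℤ → Sym' A} (h : IsZ T R Q M z) (k : ℤ) :
    IsZ T R Q M (fun j => z (j + k)) := fun i => ZAt_shift (h (i + k))

theorem Vh_shift {z z' : ℤ → Sym' A} {i k : ℤ} :
    Vh T M (fun j => z (j + k)) (fun j => z' (j + k)) i ↔ Vh T M z z' (i + k) := by
  constructor
  · intro H u u' hu hu' h
    have := H _ _ (path_shift hu k) (path_shift hu' k) fun j h1 h2 => h (j + k) (by omega) (by omega)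
    simpa using this
  · intro H u u' hu hu' h
    have := H _ _ (path_shift hu (-k)) (path_shift hu' (-k)) fun j h1 h2 => by
      have := h (j + -k) (by omega) (by omega)
      simpa using this
    simpa using this

theorem VAt_shift {b : Prop} {z z' : ℤ → Sym' A} {i k : ℤ} :
    VAt T M b (fun j => z (j + k)) (fun j => z' (j + k)) i ↔ VAt T M b z z' (i + k) := by
  unfold VAt
  rw [Vh_shift, Vh_shift]

variable (T R Q M) in
abbrev ZS : Type := {z : ℤ → Sym' A // IsZ T R Q M z}

instance [Finite A] : SecondCountableTopology (Sym' A) :=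
  DiscreteTopology.secondCountableTopology_of_countable

instance [Finite A] : SecondCountableTopology (ZS T R Q M) :=
  TopologicalSpace.Subtype.secondCountableTopology {z : ℤ → Sym' A | IsZ T R Q M z}

instance [Finite A] : CompactSpace (ZS T R Q M) := by
  have hc : IsClosed {z : ℤ → Sym' A | IsZ T R Q M z} := by
    have : {z : ℤ → Sym' A | IsZ T R Q M z} = ⋂ i, {z | ZAt T R Q M z i} := by
      ext z; rw [mem_iInter]; exact Iff.rfl
    rw [this]
    exact isClosed_iInter fun i => (isClopen_ZAt i).isClosed
  exact isCompact_iff_compactSpace.1 hc.isCompact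

variable (T R Q M) in
def ZSσ : Equiv.Perm (ZS T R Q M) where
  toFun z := ⟨fun j => z.1 (j + 1), IsZ_shift z.2 1⟩
  invFun z := ⟨fun j => z.1 (j + -1), IsZ_shift z.2 (-1)⟩
  left_inv z := by
    apply Subtype.ext; funext j
    change z.1 (j + -1 + 1) = z.1 j
    exact congrArg z.1 (by ring)
  right_inv z := by
    apply Subtype.ext; funext j
    change z.1 (j + 1 + -1) = z.1 j
    exact congrArg z.1 (by ring)

theorem ZSσ_cont : Continuous (ZSσ T R Q M) := by
  rw [continuous_induced_rng]
  refine continuous_pi fun j => ?_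
  exact (continuous_apply (j + 1)).comp continuous_subtype_val

theorem ZSσ_cont' : Continuous (ZSσ T R Q M).symm := by
  rw [continuous_induced_rng]
  refine continuous_pi fun j => ?_
  exact (continuous_apply (j + -1)).comp continuous_subtype_val

theorem ZSσ_zpow (k : ℤ) (z : ZS T R Q M) : ((ZSσ T R Q M ^ k) z).1 = fun j => z.1 (j + k) := by
  induction k using Int.induction_on generalizing z with
  | zero => simp
  | succ n ih =>
    rw [zpow_add_one, Equiv.Perm.mul_apply, ih]
    funext j
    change z.1 (j + n + 1) = _
    exact congrArg z.1 (by ring)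
  | pred n ih =>
    rw [zpow_sub_one, Equiv.Perm.mul_apply, ih]
    funext j
    change z.1 (j + (-n) + -1) = _
    exact congrArg z.1 (by ring)

theorem V_zpow {b : Prop} (z z' : ZS T R Q M) (i : ℤ) :
    VAt T M b ((ZSσ T R Q M ^ i) z).1 ((ZSσ T R Q M ^ i) z').1 0 ↔ VAt T M b z.1 z'.1 i := by
  rw [ZSσ_zpow, ZSσ_zpow, VAt_shift, zero_add]

theorem V_clopen (b : Prop) : IsClopen {p : ZS T R Q M × ZS T R Q M | VAt T M b p.1.1 p.2.1 0} := by
  have h := isClopen_of_local (B := Sym' A × Sym' A)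
    (fun w => VAt T M b (fun i => (w i).1) (fun i => (w i).2) 0) (Set.Icc 0 (M : ℤ))
    (Set.finite_Icc _ _) (by
      intro w w' hw h
      have e0 := hw 0 ⟨le_rfl, by omega⟩
      obtain ⟨h1, h2, h3⟩ := h
      refine ⟨fun u u' hu hu' hh => ?_, fun u u' hu hu' hh => ?_, fun hb => ?_⟩
      · simp only [← e0]; refine h1 u u' hu hu' fun j a1 a2 => ?_
        simp only [hw j ⟨a1, by omega⟩]; exact hh j a1 a2
      · simp only [← e0]; refine h2 u u' hu hu' fun j a1 a2 => ?_
        simp only [hw j ⟨a1, by omega⟩]; exact hh j a1 a2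
      · simp only [← e0]; exact h3 hb)
  refine h.preimage (f := fun p : ZS T R Q M × ZS T R Q M => fun i => (p.1.1 i, p.2.1 i)) ?_
  refine continuous_pi fun i => Continuous.prodMk ?_ ?_
  · exact (continuous_apply i).comp (continuous_subtype_val.comp continuous_fst)
  · exact (continuous_apply i).comp (continuous_subtype_val.comp continuous_snd)

theorem V_equiv (hC : Core T R Q M) (b : Prop) : Equivalence (fun z z' : ZS T R Q M =>
    ∀ i : ℤ, VAt T M b ((ZSσ T R Q M ^ i) z).1 ((ZSσ T R Q M ^ i) z').1 0) := by
  simp only [V_zpow]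
  exact ⟨fun z i => V_refl hC z.2 b i, fun {z z'} h i => V_symm z.2 z'.2 b h i,
    fun {z z' z''} h h' i => V_trans hC z.2 z'.2 z''.2 b h h' i⟩

theorem unstable_pair {W : Type} [MetricSpace W] (g : Equiv.Perm W) {w a b : W}
    (ha : a ∈ unstableSet g w) (hb : b ∈ unstableSet g w) :
    Tendsto (fun n : ℕ => dist ((g ^ (-(n : ℤ))) a) ((g ^ (-(n : ℤ))) b)) atTop (𝓝 0) := by
  have h : Tendsto (fun n : ℕ => dist ((g ^ (-(n : ℤ))) w) ((g ^ (-(n : ℤ))) a) +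
      dist ((g ^ (-(n : ℤ))) w) ((g ^ (-(n : ℤ))) b)) atTop (𝓝 0) := by
    have := Tendsto.add ha hb
    simpa using this
  exact squeeze_zero (fun _ => dist_nonneg) (fun n => dist_triangle_left _ _ _) h

theorem stable_pair {W : Type} [MetricSpace W] (g : Equiv.Perm W) {w a b : W}
    (ha : a ∈ stableSet g w) (hb : b ∈ stableSet g w) :
    Tendsto (fun n : ℕ => dist ((g ^ ((n : ℤ))) a) ((g ^ ((n : ℤ))) b)) atTop (𝓝 0) := by
  have h : Tendsto (fun n : ℕ => dist ((g ^ ((n : ℤ))) w) ((g ^ ((n : ℤ))) a) +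
      dist ((g ^ ((n : ℤ))) w) ((g ^ ((n : ℤ))) b)) atTop (𝓝 0) := by
    have := Tendsto.add ha hb
    simpa using this
  exact squeeze_zero (fun _ => dist_nonneg) (fun n => dist_triangle_left _ _ _) h

theorem core_main [Finite A] [TopologicalSpace A] [DiscreteTopology A] (hC : Core T R Q M)
    {X Y : Type} [MetricSpace X] [MetricSpace Y]
    (F : Equiv.Perm X) (f : Equiv.Perm Y) (π : X → Y) (hπ : IsFactorMap F f π)
    (p : (ℤ → A) → X) (hpc : ContinuousOn p {t | Path' T t})
    (hps : ∀ x, ∃ t, Path' T t ∧ p t = x)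
    (hpe : ∀ t, Path' T t → p (fun j => t (j + 1)) = F (p t))
    (hpQ : ∀ u v, Path' T u → Path' T v → (p u = p v ↔ ∀ j, Q (u j) (v j)))
    (hpR : ∀ u v, Path' T u → Path' T v → (π (p u) = π (p v) ↔ ∀ j, R (u j) (v j))) :
    ∃ (Xt Yt : Type) (mX : MetricSpace Xt) (cX : CompactSpace Xt)
      (mY : MetricSpace Yt) (cY : CompactSpace Yt)
      (Ft : Equiv.Perm Xt) (gt : Equiv.Perm Yt)
      (φ : Xt → X) (θ : Yt → Y) (πt : Xt → Yt),
      IsSmale Ft ∧ IsSmale gt ∧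
      IsFactorMap Ft F φ ∧ IsFactorMap gt f θ ∧ IsFactorMap Ft gt πt ∧
      UResolving Ft φ ∧ UResolving gt θ ∧ SResolving Ft πt ∧
      π ∘ φ = θ ∘ πt := by
  obtain ⟨Xt, mX, cX, Ft, prX, cprX, sprX, kX, eX⟩ := exists_quotient_system (ZSσ T R Q M)
    ZSσ_cont ZSσ_cont' (fun z z' => VAt T M True z.1 z'.1 0) (V_clopen True) (V_equiv hC True)
  obtain ⟨Yt, mY, cY, gt, prY, cprY, sprY, kY, eY⟩ := exists_quotient_system (ZSσ T R Q M)
    ZSσ_cont ZSσ_cont' (fun z z' => VAt T M False z.1 z'.1 0) (V_clopen False) (V_equiv hC False)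
  have br : ∀ b : Prop, ∀ n : ℕ, ∃ m : ℕ, ∀ z z' : ZS T R Q M,
      (∀ i : ℤ, -(m : ℤ) ≤ i → i ≤ m →
        VAt T M b ((ZSσ T R Q M ^ i) z).1 ((ZSσ T R Q M ^ i) z').1 0) →
      ∃ z'' : ZS T R Q M, (∀ i : ℤ, -(n : ℤ) ≤ i →
        VAt T M b ((ZSσ T R Q M ^ i) z).1 ((ZSσ T R Q M ^ i) z'').1 0) ∧
        (∀ i : ℤ, i ≤ n → VAt T M b ((ZSσ T R Q M ^ i) z').1 ((ZSσ T R Q M ^ i) z'').1 0) := by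
    intro b n
    refine ⟨n + 2 * M, fun z z' h => ?_⟩
    simp only [V_zpow] at h ⊢
    obtain ⟨z'', hz'', h1, h2⟩ := bracket hC z.2 z'.2 n ((n + 2 * M : ℕ) : ℤ) (by omega)
      (by push_cast; ring) h
    exact ⟨⟨z'', hz''⟩, h1, h2⟩
  have sX : IsSmale Ft := smale_of_cover _ (fun z z' => VAt T M True z.1 z'.1 0) prX Ft ZSσ_cont ZSσ_cont' (V_clopen True) cprX kX eX
    sprX (br True)
  have sY : IsSmale gt := smale_of_cover _ (fun z z' => VAt T M False z.1 z'.1 0) prY gt ZSσ_cont ZSσ_cont' (V_clopen False) cprY kY eY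
    sprY (br False)
  have aX := asym_neg _ (fun z z' => VAt T M True z.1 z'.1 0) prX Ft (V_clopen True) cprX kX eX
  have aY := asym_neg _ (fun z z' => VAt T M False z.1 z'.1 0) prY gt (V_clopen False) cprY kY eY
  have bX := asym_pos _ (fun z z' => VAt T M True z.1 z'.1 0) prX Ft (V_clopen True) cprX kX eX
  simp only [V_zpow] at kX kY aX aY bX
  let tt : ZS T R Q M → ℤ → A := fun z i => (z.1 i).t
  have ptt : ∀ z, Path' T (tt z) := fun z => z.2.path
  have ctt : Continuous tt := continuous_pi fun i =>
    (continuous_of_discreteTopology (f := fun s : Sym' A => s.t)).comp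
      ((continuous_apply i).comp continuous_subtype_val)
  have cp : Continuous fun z => p (tt z) := hpc.comp_continuous ctt ptt
  have eqX : ∀ z z', prX z = prX z' → p (tt z) = p (tt z') := by
    intro z z' h
    rw [kX] at h
    exact (hpQ _ _ (ptt z) (ptt z')).2 fun j => z.2.eQ ((h j).2.2 trivial)
  have eqY : ∀ z z', prY z = prY z' → π (p (tt z)) = π (p (tt z')) := by
    intro z z' h
    rw [kY] at h
    exact (hpR _ _ (ptt z) (ptt z')).2 fun j => Vh_R z.2 z'.2 (h j).1
  have eqXY : ∀ z z', prX z = prX z' → prY z = prY z' := by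
    intro z z' h
    rw [kX] at h; rw [kY]
    exact fun i => ⟨(h i).1, (h i).2.1, False.elim⟩
  obtain ⟨φ, cφ, hφ⟩ := factor_exists prX cprX sprX _ cp eqX
  obtain ⟨θ, cθ, hθ⟩ := factor_exists prY cprY sprY _ (hπ.1.comp cp) eqY
  obtain ⟨πt, cπt, hπt⟩ := factor_exists prX cprX sprX _ cprY eqXY
  have hsur : ∀ x, ∃ z, p (tt z) = x := by
    intro x
    obtain ⟨t, ht, rfl⟩ := hps x
    obtain ⟨z, hz, hzt⟩ := exists_lift hC ht
    exact ⟨⟨z, hz⟩, congrArg p (funext hzt)⟩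
  have htσ : ∀ z, p (tt (ZSσ T R Q M z)) = F (p (tt z)) := fun z => hpe (tt z) (ptt z)
  refine ⟨Xt, Yt, mX, cX, mY, cY, Ft, gt, φ, θ, πt, sX, sY, ⟨cφ, ?_, ?_⟩, ⟨cθ, ?_, ?_⟩,
    ⟨cπt, ?_, ?_⟩, ?_, ?_, ?_, ?_⟩
  · intro x
    obtain ⟨z, hz⟩ := hsur x
    exact ⟨prX z, by rw [hφ, hz]⟩
  · intro w
    obtain ⟨z, rfl⟩ := sprX w
    rw [← eX, hφ, hφ, htσ]
  · intro y
    obtain ⟨x, rfl⟩ := hπ.2.1 y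
    obtain ⟨z, hz⟩ := hsur x
    exact ⟨prY z, by rw [hθ]; exact congrArg π hz⟩
  · intro w
    obtain ⟨z, rfl⟩ := sprY w
    rw [← eY, hθ, hθ]
    change π (p (tt _)) = f (π (p (tt z)))
    rw [htσ, hπ.2.2]
  · intro w
    obtain ⟨z, rfl⟩ := sprY w
    exact ⟨prX z, hπt z⟩
  · intro w
    obtain ⟨z, rfl⟩ := sprX w
    rw [← eX, hπt, hπt, eY]
  · intro w a ha b hb hab
    have hT := unstable_pair Ft ha hb
    obtain ⟨z, rfl⟩ := sprX a
    obtain ⟨z', rfl⟩ := sprX b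
    obtain ⟨i₀, hi₀⟩ := aX z z' hT
    rw [hφ, hφ] at hab
    rw [kX]
    exact core_ures hC z.2 z'.2 hi₀ ((hpR _ _ (ptt z) (ptt z')).1 (congrArg π hab))
      (fun _ => (hpQ _ _ (ptt z) (ptt z')).1 hab)
  · intro w a ha b hb hab
    have hT := unstable_pair gt ha hb
    obtain ⟨z, rfl⟩ := sprY a
    obtain ⟨z', rfl⟩ := sprY b
    obtain ⟨i₀, hi₀⟩ := aY z z' hT
    rw [hθ, hθ] at hab
    rw [kY]
    exact core_ures hC z.2 z'.2 hi₀ ((hpR _ _ (ptt z) (ptt z')).1 hab) False.elim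
  · intro w a ha b hb hab
    have hT := stable_pair Ft ha hb
    obtain ⟨z, rfl⟩ := sprX a
    obtain ⟨z', rfl⟩ := sprX b
    obtain ⟨i₀, hi₀⟩ := bX z z' hT
    rw [hπt, hπt, kY] at hab
    rw [kX]
    exact core_sres hC z.2 z'.2 hi₀ hab
  · funext w
    obtain ⟨z, rfl⟩ := sprX w
    simp only [Function.comp]
    rw [hφ, hπt, hθ]
    rfl

end core3

/-- presentation of a system by a vertex shift, with uniform continuity spelled out -/
structure Pres {A X : Type} [MetricSpace X] (F : Equiv.Perm X) (T : A → A → Prop)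
    (p : (ℤ → A) → X) : Prop where
  ucont : ∀ ε > 0, ∃ n : ℕ, ∀ u v, Path' T u → Path' T v →
    (∀ j : ℤ, -(n : ℤ) ≤ j → j ≤ n → u j = v j) → dist (p u) (p v) < ε
  surj : ∀ x, ∃ t, Path' T t ∧ p t = x
  eqv : ∀ t, Path' T t → p (fun j => t (j + 1)) = F (p t)

theorem eqv_zpow {A X : Type} {F : Equiv.Perm X} {T : A → A → Prop} {h : (ℤ → A) → X}
    (eqv : ∀ t, Path' T t → h (fun j => t (j + 1)) = F (h t)) {t : ℤ → A} (ht : Path' T t) (k : ℤ) :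
    h (fun j => t (j + k)) = (F ^ k) (h t) := by
  induction k using Int.induction_on with
  | zero => simp
  | succ n ih =>
    have := eqv _ (path_shift ht n)
    rw [ih] at this
    rw [add_comm, zpow_one_add, Equiv.Perm.mul_apply, ← this]
    congr 1; funext j; congr 1; ring
  | pred n ih =>
    have := eqv _ (path_shift ht (-(n : ℤ) - 1))
    have e : (fun j : ℤ => t (j + 1 + (-(n : ℤ) - 1))) = fun j => t (j + -(n : ℤ)) := by
      funext j; congr 1; ring
    simp only [e, ih] at this
    have h2 : (F ^ (-(n : ℤ))) (h t) = F ((F ^ (-(n : ℤ) - 1)) (h t)) := by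
      rw [← Equiv.Perm.mul_apply, ← zpow_one_add]; congr 2; ring
    rw [h2] at this
    exact (F.injective this).symm

theorem uniform_expansive {X : Type} [MetricSpace X] [CompactSpace X] {F : Equiv.Perm X}
    (h1 : Continuous F) (h2 : Continuous F.symm) {c : ℝ} (hc : Expansive F c) {ε : ℝ} (hε : 0 < ε) :
    ∃ M : ℕ, ∀ x y, (∀ k : ℤ, -(M : ℤ) ≤ k → k ≤ M → dist ((F ^ k) x) ((F ^ k) y) ≤ c) →
      dist x y ≤ ε := by
  by_contra hcon
  push Not at hcon
  let K : ℕ → Set (X × X) := fun n =>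
    (⋂ i ∈ Set.Icc (-(n : ℤ)) n, {p : X × X | dist ((F ^ i) p.1) ((F ^ i) p.2) ≤ c}) ∩
      {p | ε ≤ dist p.1 p.2}
  have hKc : ∀ n, IsClosed (K n) := fun n => by
    refine (isClosed_biInter fun i _ => ?_).inter (isClosed_le continuous_const (by fun_prop))
    have := continuous_zpow_perm F h1 h2 i
    exact isClosed_le (by fun_prop) continuous_const
  obtain ⟨p, hp⟩ := IsCompact.nonempty_iInter_of_sequence_nonempty_isCompact_isClosed K
    (fun n p hp => ⟨by
      have := hp.1
      simp only [mem_iInter, mem_Icc] at this ⊢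
      intro i hi
      exact this i ⟨by push_cast; omega, by push_cast; omega⟩, hp.2⟩)
    (fun n => by
      obtain ⟨z, z', h, h'⟩ := hcon n
      refine ⟨(z, z'), ?_, h'.le⟩
      simp only [mem_iInter, mem_Icc]
      exact fun i hi => h i hi.1 hi.2)
    (hKc 0).isCompact hKc
  rw [mem_iInter] at hp
  have h0 : ε ≤ dist p.1 p.2 := (hp 0).2
  have hne : p.1 ≠ p.2 := by
    intro h; rw [h, dist_self] at h0; linarith
  obtain ⟨n, hn⟩ := hc _ _ hne
  have := (hp n.natAbs).1
  simp only [mem_iInter, mem_Icc] at this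
  exact absurd (this n ⟨by omega, by omega⟩) (not_le.2 hn)

def RelOf {A X : Type} [MetricSpace X] (T : A → A → Prop) (h : (ℤ → A) → X) (ε : ℝ) (a b : A) :
    Prop := ∃ u v, Path' T u ∧ Path' T v ∧ u 0 = a ∧ v 0 = b ∧ dist (h u) (h v) ≤ ε

structure RelFacts {A X : Type} (T : A → A → Prop) (h : (ℤ → A) → X) (R : A → A → Prop)
    (M : ℕ) : Prop where
  symm : ∀ a b, R a b → R b a
  iff : ∀ u v, Path' T u → Path' T v → (h u = h v ↔ ∀ j, R (u j) (v j))
  R3 : ∀ u v, Path' T u → Path' T v → ∀ i : ℤ, (∀ j ≤ i + M, Comp2 R (u j) (v j)) →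
    ∀ j ≤ i, R (u j) (v j)
  R3a : ∀ u v, Path' T u → Path' T v → (∀ j, Comp2 R (u j) (v j)) → h u = h v

theorem relFacts_exists {A X : Type} [MetricSpace X] [CompactSpace X] {F : Equiv.Perm X}
    (h1 : Continuous F) (h2 : Continuous F.symm) {c : ℝ} (hc : Expansive F c)
    {T : A → A → Prop} {h : (ℤ → A) → X}
    (eqv : ∀ t, Path' T t → h (fun j => t (j + 1)) = F (h t)) {ε : ℝ} (hε : 0 < ε)
    (hεc : 6 * ε ≤ c) (hfine : ∀ u v, Path' T u → Path' T v → u 0 = v 0 → dist (h u) (h v) ≤ ε) :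
    ∃ R M, RelFacts T h R M := by
  obtain ⟨M, hM⟩ := uniform_expansive h1 h2 hc hε
  have d3 : ∀ u v, Path' T u → Path' T v → RelOf T h ε (u 0) (v 0) → dist (h u) (h v) ≤ 3 * ε := by
    rintro u v hu hv ⟨u', v', hu', hv', eu, ev, hd⟩
    have a1 := hfine u u' hu hu' eu.symm
    have a2 := hfine v' v hv' hv ev
    have := dist_triangle4 (h u) (h u') (h v') (h v)
    linarith
  have d6 : ∀ u v, Path' T u → Path' T v → Comp2 (RelOf T h ε) (u 0) (v 0) →
      dist (h u) (h v) ≤ c := by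
    rintro u v hu hv ⟨b, hb1, hb2⟩
    obtain ⟨w, hw, rfl⟩ : ∃ w, Path' T w ∧ w 0 = b := by
      obtain ⟨_, w, _, hw, _, e, _⟩ := hb1
      exact ⟨w, hw, e⟩
    have a1 := d3 u w hu hw hb1
    have a2 := d3 w v hw hv hb2
    have := dist_triangle (h u) (h w) (h v)
    linarith
  have sh : ∀ u, Path' T u → ∀ k, h (fun j => u (j + k)) = (F ^ k) (h u) :=
    fun u hu k => eqv_zpow eqv hu k
  have d6' : ∀ u v, Path' T u → Path' T v → ∀ j, Comp2 (RelOf T h ε) (u j) (v j) →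
      dist ((F ^ j) (h u)) ((F ^ j) (h v)) ≤ c := by
    intro u v hu hv j hj
    rw [← sh u hu, ← sh v hv]
    exact d6 _ _ (path_shift hu j) (path_shift hv j) (by simpa using hj)
  have R3a : ∀ u v, Path' T u → Path' T v → (∀ j, Comp2 (RelOf T h ε) (u j) (v j)) →
      h u = h v := by
    intro u v hu hv hj
    by_contra hne
    obtain ⟨n, hn⟩ := hc _ _ hne
    exact absurd (d6' u v hu hv n (hj n)) (not_le.2 hn)
  refine ⟨RelOf T h ε, M, ?_, ?_, ?_, R3a⟩
  · rintro a b ⟨u, v, hu, hv, e, e', hd⟩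
    exact ⟨v, u, hv, hu, e', e, by rwa [dist_comm]⟩
  · intro u v hu hv
    constructor
    · intro huv j
      refine ⟨_, _, path_shift hu j, path_shift hv j, by simp, by simp, ?_⟩
      rw [sh u hu, sh v hv, huv, dist_self]; exact hε.le
    · intro hj
      refine R3a u v hu hv fun j => ⟨_, hj j, ?_⟩
      exact ⟨_, _, path_shift hv j, path_shift hv j, by simp, by simp, by rw [dist_self]; exact hε.le⟩
  · intro u v hu hv i hj j hji
    refine ⟨_, _, path_shift hu j, path_shift hv j, by simp, by simp, ?_⟩
    apply hM
    intro k hk1 hk2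
    rw [sh u hu, sh v hv, zpow_add_perm, zpow_add_perm]
    exact d6' u v hu hv _ (hj _ (by omega))

/-- ultrafilter limits of symbol sequences -/
theorem ultra_limit {ι A : Type} [Finite A] (U : Ultrafilter ι) (s : ι → ℤ → A) :
    ∃ t : ℤ → A, ∀ a b : ℤ, ∀ᶠ n in (U : Filter ι), ∀ j, a ≤ j → j ≤ b → s n j = t j := by
  have h1 : ∀ j, ∃ a, ∀ᶠ n in (U : Filter ι), s n j = a := by
    intro j
    by_contra hcon
    push Not at hcon
    have : ∀ a, ∀ᶠ n in (U : Filter ι), s n j ≠ a := fun a =>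
      Ultrafilter.eventually_not.2 (Ultrafilter.frequently_iff_eventually.not.1 (by simpa using hcon a))
    obtain ⟨n, hn⟩ := (eventually_all.2 this).exists
    exact hn _ rfl
  choose t ht using h1
  refine ⟨t, fun a b => ?_⟩
  have := (Set.finite_Icc a b).eventually_all (l := (U : Filter ι)) (p := fun j n => s n j = t j)
  have h3 := this.2 fun j _ => ht j
  filter_upwards [h3] with n hn j h1 h2
  exact hn j ⟨h1, h2⟩

theorem ultra_path {ι A : Type} {T : A → A → Prop} (U : Ultrafilter ι) {s : ι → ℤ → A}
    (hs : ∀ n, Path' T (s n)) {t : ℤ → A}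
    (ht : ∀ a b : ℤ, ∀ᶠ n in (U : Filter ι), ∀ j, a ≤ j → j ≤ b → s n j = t j) : Path' T t := by
  intro i
  obtain ⟨n, hn⟩ := (ht i (i + 1)).exists
  rw [← hn i (by omega) (by omega), ← hn (i + 1) (by omega) (by omega)]
  exact hs n i

theorem ultra_tendsto {ι A X : Type} [MetricSpace X] {F : Equiv.Perm X} {T : A → A → Prop}
    {p : (ℤ → A) → X} (hp : Pres F T p) (U : Ultrafilter ι) {s : ι → ℤ → A}
    (hs : ∀ n, Path' T (s n)) {t : ℤ → A}
    (ht : ∀ a b : ℤ, ∀ᶠ n in (U : Filter ι), ∀ j, a ≤ j → j ≤ b → s n j = t j) :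
    Tendsto (fun n => p (s n)) (U : Filter ι) (𝓝 (p t)) := by
  rw [Metric.tendsto_nhds]
  intro ε hε
  obtain ⟨n, hn⟩ := hp.ucont ε hε
  filter_upwards [ht (-(n : ℤ)) n] with k hk
  exact hn _ _ (hs k) (ultra_path U hs ht) hk

/-- Step 1: block presentation. -/
theorem block_presentation {X : Type} [MetricSpace X] {F : Equiv.Perm X}
    (hX : FinitelyPresented F) {η : ℝ} (hη : 0 < η) :
    ∃ (A : Type) (_ : Finite A) (T : A → A → Prop) (p : (ℤ → A) → X), Pres F T p ∧
      (∀ a, ∃ t, Path' T t ∧ t 0 = a) ∧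
      ∀ u v, Path' T u → Path' T v → u 0 = v 0 → dist (p u) (p v) ≤ η := by
  obtain ⟨-, -, -, N, S, ⟨Fw, hFw, hS⟩, hinv, -, φ, hφc, hφs, hφe⟩ := hX
  -- S is closed
  have hSc : IsClosed S := by
    have : S = ⋂ w ∈ Fw, ⋂ i : ℤ, {x | ¬ ∀ j : Fin w.1, x (i + (j : ℤ)) = w.2 j} := by
      rw [hS]; ext x
      simp only [mem_iInter, OccursIn, not_exists]
      exact Iff.rfl
    rw [this]
    refine isClosed_biInter fun w _ => isClosed_iInter fun i => ?_
    refine (isClopen_of_local _ (Set.range fun j : Fin w.1 => i + (j : ℤ)) (Set.finite_range _) ?_).isClosed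
    intro z z' h hz hz'
    exact hz fun j => by rw [h _ ⟨j, rfl⟩]; exact hz' j
  have huc : ∀ ε > 0, ∃ n : ℕ, ∀ u ∈ S, ∀ v ∈ S, (∀ j : ℤ, -(n : ℤ) ≤ j → j ≤ n → u j = v j) →
      dist (φ u) (φ v) < ε := by
    intro ε hε
    by_contra hcon
    push Not at hcon
    have : CompactSpace S := isCompact_iff_compactSpace.1 hSc.isCompact
    have hφc' : Continuous fun x : S => φ x.1 := continuousOn_iff_continuous_domRestrict.1 hφc
    let K : ℕ → Set (S × S) := fun n =>
      (⋂ i ∈ Set.Icc (-(n : ℤ)) n, {p : S × S | p.1.1 i = p.2.1 i}) ∩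
        {p | ε ≤ dist (φ p.1.1) (φ p.2.1)}
    have hKc : ∀ n, IsClosed (K n) := fun n => by
      refine (isClosed_biInter fun i _ => ?_).inter (isClosed_le continuous_const ?_)
      · exact isClosed_eq ((continuous_apply i).comp (continuous_subtype_val.comp continuous_fst))
          ((continuous_apply i).comp (continuous_subtype_val.comp continuous_snd))
      · exact (hφc'.comp continuous_fst).dist (hφc'.comp continuous_snd)
    obtain ⟨p, hp⟩ := IsCompact.nonempty_iInter_of_sequence_nonempty_isCompact_isClosed K
      (fun n p hp => ⟨by
        have := hp.1
        simp only [mem_iInter, mem_Icc] at this ⊢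
        intro i hi
        exact this i ⟨by push_cast; omega, by push_cast; omega⟩, hp.2⟩)
      (fun n => by
        obtain ⟨z, hz, z', hz', h, h'⟩ := hcon n
        refine ⟨(⟨z, hz⟩, ⟨z', hz'⟩), ?_, h'⟩
        simp only [mem_iInter, mem_Icc]
        exact fun i hi => h i hi.1 hi.2)
      (hKc 0).isCompact hKc
    rw [mem_iInter] at hp
    have h0 : ε ≤ dist (φ p.1.1) (φ p.2.1) := (hp 0).2
    have : p.1.1 = p.2.1 := by
      funext i
      have := (hp i.natAbs).1
      simp only [mem_iInter, mem_Icc] at this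
      exact this i ⟨by omega, by omega⟩
    rw [this, dist_self] at h0
    linarith
  obtain ⟨m₁, hm₁⟩ := huc η hη
  obtain ⟨m₂, hm₂⟩ : ∃ m : ℕ, ∀ w ∈ Fw, w.1 ≤ m := by
    obtain ⟨m, hm⟩ := (hFw.image fun w => w.1).bddAbove
    exact ⟨m, fun w hw => hm ⟨w, hw, rfl⟩⟩
  obtain ⟨m, h1m, h2m⟩ : ∃ m : ℕ, m₁ ≤ m ∧ m₂ ≤ m := ⟨max m₁ m₂, le_max_left _ _, le_max_right _ _⟩
  let r : (ℤ → Fin N) → (Set.Icc (-(m : ℤ)) m → Fin N) := fun x j => x j.1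
  let A : Type := {a : Set.Icc (-(m : ℤ)) m → Fin N // ∃ x ∈ S, r x = a}
  let T : A → A → Prop := fun a b => ∃ x ∈ S, r x = a.1 ∧ r (fun j => x (j + 1)) = b.1
  let z0 : Set.Icc (-(m : ℤ)) m := ⟨0, by omega, by omega⟩
  let dec : (ℤ → A) → (ℤ → Fin N) := fun t i => (t i).1 z0
  have hshift : ∀ x ∈ S, ∀ k : ℤ, (fun j => x (j + k)) ∈ S := by
    intro x hx k
    rw [hS] at hx ⊢
    rintro w hw ⟨i, hi⟩
    exact hx w hw ⟨i + k, fun j => by rw [← hi j]; congr 1; ring⟩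
  -- reading windows
  have key : ∀ t, Path' T t → ∀ i j : ℤ, (hj : j ∈ Set.Icc (-(m : ℤ)) m) →
      (t i).1 ⟨j, hj⟩ = dec t (i + j) := by
    intro t ht
    have step : ∀ i j : ℤ, (hj : j ∈ Set.Icc (-(m : ℤ)) m) → (hj' : j + 1 ∈ Set.Icc (-(m : ℤ)) m) →
        (t i).1 ⟨j + 1, hj'⟩ = (t (i + 1)).1 ⟨j, hj⟩ := by
      intro i j hj hj'
      obtain ⟨x, hx, e1, e2⟩ := ht i
      rw [← e1, ← e2]
    have pos : ∀ n : ℕ, ∀ i : ℤ, (hj : (n : ℤ) ∈ Set.Icc (-(m : ℤ)) m) →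
        (t i).1 ⟨n, hj⟩ = dec t (i + n) := by
      intro n
      induction n with
      | zero => intro i hj; simp only [dec, z0]; congr 2 <;> simp
      | succ n ih =>
        intro i hj
        have hj0 : (n : ℤ) ∈ Set.Icc (-(m : ℤ)) m := by
          obtain ⟨_, b⟩ := hj; push_cast at b; exact ⟨by omega, by omega⟩
        have := step i n hj0 (by have := hj; push_cast at this; exact this)
        have e := this.trans (ih (i + 1) hj0)
        push_cast
        rw [e]; congr 1; ring
    have neg : ∀ n : ℕ, ∀ i : ℤ, (hj : -(n : ℤ) ∈ Set.Icc (-(m : ℤ)) m) →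
        (t i).1 ⟨-(n : ℤ), hj⟩ = dec t (i + -n) := by
      intro n
      induction n with
      | zero => intro i hj; simp only [dec, z0]; congr 2 <;> simp
      | succ n ih =>
        intro i hj
        have hj0 : -(n : ℤ) ∈ Set.Icc (-(m : ℤ)) m := by
          obtain ⟨b, _⟩ := hj; push_cast at b; exact ⟨by omega, by omega⟩
        have := step (i - 1) (-((n + 1 : ℕ) : ℤ)) hj (by
          rw [show -((n + 1 : ℕ) : ℤ) + 1 = -(n : ℤ) by push_cast; ring]; exact hj0)
        simp only [show i - 1 + 1 = i by ring] at this
        rw [← this]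
        have e2 := ih (i - 1) hj0
        rw [show i + -((n + 1 : ℕ) : ℤ) = i - 1 + -(n : ℤ) by push_cast; ring, ← e2]
        congr 2; push_cast; ring
    intro i j hj
    rcases le_total 0 j with h | h
    · obtain ⟨n, rfl⟩ := Int.eq_ofNat_of_zero_le h
      exact pos n i hj
    · obtain ⟨n, hn⟩ := Int.eq_ofNat_of_zero_le (neg_nonneg.2 h)
      obtain rfl : j = -(n : ℤ) := by omega
      exact neg n i hj
  have hdec : ∀ t, Path' T t → dec t ∈ S := by
    intro t ht
    rw [hS]
    rintro w hw ⟨i, hi⟩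
    obtain ⟨x, hx, e1⟩ := (t i).2
    rw [hS] at hx
    refine hx w hw ⟨0, fun j => ?_⟩
    have hj : (0 + (j : ℤ)) ∈ Set.Icc (-(m : ℤ)) m := by
      have := j.2; have := hm₂ w hw; exact ⟨by omega, by omega⟩
    have e2 := key t ht i _ hj
    rw [← e1] at e2
    rw [← hi j]
    simpa [r] using e2
  let enc : (x : ℤ → Fin N) → x ∈ S → ℤ → A := fun x hx i => ⟨r fun j => x (j + i), _, hshift x hx i, rfl⟩
  have henc : ∀ x hx, Path' T (enc x hx) := by
    intro x hx i
    refine ⟨_, hshift x hx i, rfl, ?_⟩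
    change r (fun j => x (j + 1 + i)) = r (fun j => x (j + (i + 1)))
    have e : (fun j : ℤ => x (j + 1 + i)) = fun j : ℤ => x (j + (i + 1)) := by
      funext j
      exact congrArg x (show j + 1 + i = j + (i + 1) by ring)
    rw [e]
  have hde : ∀ x hx, dec (enc x hx) = x := by
    intro x hx; funext i; simp [dec, enc, r, z0]
  refine ⟨A, inferInstance, T, fun t => φ (dec t), ⟨?_, ?_, ?_⟩, ?_, ?_⟩
  · intro ε hε
    obtain ⟨n, hn⟩ := huc ε hε
    refine ⟨n, fun u v hu hv h => hn _ (hdec u hu) _ (hdec v hv) fun j h1 h2 => ?_⟩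
    simp only [dec, h j h1 h2]
  · intro x
    have : x ∈ φ '' S := by rw [hφs]; trivial
    obtain ⟨y, hy, rfl⟩ := this
    exact ⟨enc y hy, henc y hy, congrArg φ (hde y hy)⟩
  · intro t ht
    exact hφe _ (hdec t ht)
  · rintro ⟨a, x, hx, rfl⟩
    refine ⟨enc x hx, henc x hx, ?_⟩
    apply Subtype.ext
    funext j; simp [enc, r]
  · intro u v hu hv h
    refine (hm₁ _ (hdec u hu) _ (hdec v hv) fun j h1 h2 => ?_).le
    have hj : j ∈ Set.Icc (-(m : ℤ)) m := ⟨by omega, by omega⟩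
    have a := key u hu 0 j hj
    have b := key v hv 0 j hj
    rw [zero_add] at a b
    rw [← a, ← b, h]

/-- lexicographic comparison of sequences -/
def LexLess {A : Type} [LinearOrder A] (v u : ℤ → A) : Prop := ∃ l, (∀ j < l, v j = u j) ∧ v l < u l

theorem LexLess.trans {A : Type} [LinearOrder A] {u v w : ℤ → A} (h1 : LexLess u v)
    (h2 : LexLess v w) : LexLess u w := by
  obtain ⟨l, a, b⟩ := h1
  obtain ⟨m, c, d⟩ := h2
  rcases lt_trichotomy l m with h | h | h
  · exact ⟨l, fun j hj => (a j hj).trans (c j (hj.trans h)), by rw [← c l h]; exact b⟩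
  · subst h; exact ⟨l, fun j hj => (a j hj).trans (c j hj), b.trans d⟩
  · exact ⟨m, fun j hj => (a j (hj.trans h)).trans (c j hj), by rw [a m h]; exact d⟩

theorem LexLess.irrefl {A : Type} [LinearOrder A] (u : ℤ → A) : ¬ LexLess u u := by
  rintro ⟨l, -, h⟩; exact lt_irrefl _ h

theorem exists_lexmin {A : Type} [LinearOrder A] (C : Set (ℤ → A)) (hC : C.Finite)
    (hne : C.Nonempty) : ∃ u ∈ C, ∀ v ∈ C, ¬ LexLess v u := by
  have := hC.to_subtype
  have i1 : IsTrans C (fun a b => LexLess a.1 b.1) := ⟨fun a b c h1 h2 => h1.trans h2⟩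
  have i2 : Std.Irrefl (fun a b : C => LexLess a.1 b.1) := ⟨fun a => LexLess.irrefl a.1⟩
  have wf := Finite.wellFounded_of_trans_of_irrefl (fun a b : C => LexLess a.1 b.1)
  obtain ⟨z, hz⟩ := hne
  obtain ⟨m, -, hm⟩ := wf.has_min univ ⟨⟨z, hz⟩, trivial⟩
  exact ⟨m.1, m.2, fun v hv => hm ⟨v, hv⟩ trivial⟩

def GoodP {A : Type} [LinearOrder A] (T Q : A → A → Prop) (t : ℤ → A) : Prop :=
  ∀ v, Path' T v → ∀ l k : ℤ, (∀ j < l, v j = t j) → v l < t l → (∀ j ≥ k, v j = t j) →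
    ¬ ∀ j, Q (v j) (t j)

theorem exists_good {A X : Type} [LinearOrder A] [Finite A] [MetricSpace X] {F : Equiv.Perm X}
    {T Q : A → A → Prop} {p : (ℤ → A) → X} (hp : Pres F T p) (Qr : ∀ a, Q a a)
    (hQ : ∀ u v, Path' T u → Path' T v → (p u = p v ↔ ∀ j, Q (u j) (v j))) (x : X) :
    ∃ t, Path' T t ∧ p t = x ∧ GoodP T Q t := by
  obtain ⟨t0, ht0, rfl⟩ := hp.surj x
  let C : ℕ → Set (ℤ → A) := fun L => {u | Path' T u ∧ p u = p t0 ∧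
    ∀ j : ℤ, (j ≤ -(L : ℤ) ∨ (L : ℤ) ≤ j) → u j = t0 j}
  have hCf : ∀ L, (C L).Finite := by
    intro L
    have : Finite (C L) := by
      refine Finite.of_injective (β := Set.Icc (-(L : ℤ)) L → A) (fun u j => u.1 j) ?_
      rintro ⟨u, hu⟩ ⟨v, hv⟩ h
      apply Subtype.ext
      funext j
      by_cases hj : -(L : ℤ) ≤ j ∧ j ≤ L
      · exact congrFun h ⟨j, hj⟩
      · have hj' : j ≤ -(L : ℤ) ∨ (L : ℤ) ≤ j := by omega
        exact (hu.2.2 j hj').trans (hv.2.2 j hj').symm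
    exact Set.toFinite _
  have hmin := fun L => exists_lexmin (C L) (hCf L) ⟨t0, ht0, rfl, fun _ _ => rfl⟩
  choose s hs hsm using hmin
  obtain ⟨t, ht⟩ := ultra_limit (Filter.hyperfilter ℕ) s
  have hsp : ∀ n, Path' T (s n) := fun n => (hs n).1
  have htp := ultra_path _ hsp ht
  refine ⟨t, htp, ?_, ?_⟩
  · have h1 := ultra_tendsto hp _ hsp ht
    have h2 : (fun n => p (s n)) = fun _ => p t0 := funext fun n => (hs n).2.1
    rw [h2] at h1
    exact (tendsto_nhds_unique h1 tendsto_const_nhds)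
  · intro v hv l k h1 h2 h3 h4
    have hlk : l < k := by
      by_contra hcon
      exact h2.ne (h3 l (by omega))
    have hbig : ∀ᶠ n : ℕ in (Filter.hyperfilter ℕ : Filter ℕ), l.natAbs + k.natAbs < n := by
      have : ∀ᶠ n : ℕ in atTop, l.natAbs + k.natAbs < n := eventually_gt_atTop _
      rw [← Nat.cofinite_eq_atTop] at this
      exact Filter.hyperfilter_le_cofinite this
    obtain ⟨n, hn, hnb⟩ := ((ht (l - 1) k).and hbig).exists
    have el : s n (l - 1) = v (l - 1) := by
      rw [h1 (l - 1) (by omega)]; exact hn _ (by omega) (by omega)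
    have ek : splice (l - 1) (s n) v k = s n k := by
      rw [splice_gt (by omega), h3 k le_rfl]; exact (hn _ (by omega) (by omega)).symm
    set w := splice k (splice (l - 1) (s n) v) (s n) with hw
    have hwp : Path' T w := path_splice (path_splice (hsp n) hv el) (hsp n) ek
    have wl : ∀ j < l, w j = s n j := fun j hj => by
      rw [hw, splice_le (by omega), splice_le (by omega)]
    have wm : ∀ j, l ≤ j → j ≤ k → w j = v j := fun j hj hj' => by
      rw [hw, splice_le (by omega), splice_gt (by omega)]
    have wr : ∀ j, k ≤ j → w j = s n j := fun j hj => by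
      rw [hw, splice_ge ek hj]
    refine hsm n w ⟨hwp, ?_, ?_⟩ ⟨l, wl, ?_⟩
    · rw [← (hs n).2.1]
      refine (hQ _ _ hwp (hsp n)).2 fun j => ?_
      rcases lt_or_ge j l with h | h
      · rw [wl j h]; exact Qr _
      · rcases le_or_gt j k with h' | h'
        · rw [wm j h h', hn j (by omega) h']; exact h4 j
        · rw [wr j h'.le]; exact Qr _
    · intro j hj
      rw [← (hs n).2.2 j hj]
      rcases hj with h | h
      · exact wl j (by omega)
      · exact wr j (by omega)
    · rw [wm l le_rfl hlk.le, hn l (by omega) hlk.le]; exact h2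

/-- follower set refinement -/
def TD {A : Type} [LinearOrder A] (T Q : A → A → Prop) (a b : A × Set A) : Prop :=
  T a.1 b.1 ∧ a.1 ∉ a.2 ∧ b.1 ∉ b.2 ∧
    ∀ c, c ∈ b.2 ↔ Q c b.1 ∧ ((∃ d ∈ a.2, T d c) ∨ (T a.1 c ∧ c < b.1))

theorem good_lift {A : Type} [LinearOrder A] {T Q : A → A → Prop} (Qr : ∀ a, Q a a)
    (ess : ∀ a, ∃ t, Path' T t ∧ t 0 = a) {t : ℤ → A} (ht : Path' T t) (hg : GoodP T Q t) :
    ∃ s : ℤ → A × Set A, Path' (TD T Q) s ∧ ∀ j, (s j).1 = t j := by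
  have ess' : ∀ a (i : ℤ), ∃ t, Path' T t ∧ t i = a := by
    intro a i
    obtain ⟨t, ht, h⟩ := ess a
    exact ⟨_, path_shift ht (-i), by simpa using h⟩
  let D : ℤ → Set A := fun i => {c | ∃ v, Path' T v ∧ ∃ l ≤ i, (∀ j < l, v j = t j) ∧ v l < t l ∧
    (∀ j ≤ i, Q (v j) (t j)) ∧ v i = c}
  have hD : ∀ i, t i ∉ D i := by
    rintro i ⟨v, hv, l, hl, h1, h2, h3, h4⟩
    refine hg _ (path_splice hv ht h4) l i ?_ ?_ ?_ ?_
    · intro j hj; rw [splice_le (by omega)]; exact h1 j hj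
    · rw [splice_le hl]; exact h2
    · intro j hj; exact splice_ge h4 hj
    · intro j
      rcases le_or_gt j i with h | h
      · rw [splice_le h]; exact h3 j h
      · rw [splice_gt h]; exact Qr _
  refine ⟨fun i => (t i, D i), fun i => ⟨ht i, hD i, hD (i + 1), fun c => ⟨?_, ?_⟩⟩, fun j => rfl⟩
  · rintro ⟨v, hv, l, hl, h1, h2, h3, rfl⟩
    refine ⟨h3 _ le_rfl, ?_⟩
    rcases (show l ≤ i ∨ l = i + 1 by omega) with h | h
    · exact Or.inl ⟨v i, ⟨v, hv, l, h, h1, h2, fun j hj => h3 j (by omega), rfl⟩, hv i⟩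
    · subst h
      refine Or.inr ⟨?_, h2⟩
      have := hv i
      rwa [h1 i (by omega)] at this
  · rintro ⟨hq, h⟩
    obtain ⟨w, hw, hwc⟩ := ess' c (i + 1)
    rcases h with ⟨d, ⟨v, hv, l, hl, h1, h2, h3, rfl⟩, hT⟩ | ⟨hT, hlt⟩
    · refine ⟨_, path_splice_gt hv hw (by rw [hwc]; exact hT), l, by omega, ?_, ?_, ?_, ?_⟩
      · intro j hj; rw [splice_le (by omega)]; exact h1 j hj
      · rw [splice_le hl]; exact h2
      · intro j hj
        rcases (show j ≤ i ∨ j = i + 1 by omega) with h | h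
        · rw [splice_le h]; exact h3 j h
        · subst h; rw [splice_gt (by omega), hwc]; exact hq
      · rw [splice_gt (by omega), hwc]
    · refine ⟨_, path_splice_gt ht hw (by rw [hwc]; exact hT), i + 1, le_rfl, ?_, ?_, ?_, ?_⟩
      · intro j hj; rw [splice_le (by omega)]
      · rw [splice_gt (by omega), hwc]; exact hlt
      · intro j hj
        rcases (show j ≤ i ∨ j = i + 1 by omega) with h | h
        · rw [splice_le h]; exact Qr _
        · subst h; rw [splice_gt (by omega), hwc]; exact hq
      · rw [splice_gt (by omega), hwc]

theorem TD_aux {A : Type} [LinearOrder A] {T Q : A → A → Prop} {u v : ℤ → A × Set A}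
    (hu : Path' (TD T Q) u) (hv : Path' (TD T Q) v) {m l : ℤ}
    (hm : ∀ j < m, (u j).1 = (v j).1) (hlt : (v m).1 < (u m).1)
    (hl : ∀ j ≥ l, (u j).1 = (v j).1) (hQ : ∀ j, Q (v j).1 (u j).1) : False := by
  have key : ∀ n : ℕ, (v (m + n)).1 ∈ (u (m + n)).2 := by
    intro n
    induction n with
    | zero =>
      have h1 := (hu (m - 1)).2.2.2 (v m).1
      rw [sub_add_cancel] at h1
      simp only [Nat.cast_zero, add_zero]
      refine h1.2 ⟨hQ m, Or.inr ⟨?_, hlt⟩⟩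
      have := (hv (m - 1)).1
      rw [sub_add_cancel] at this
      rwa [hm (m - 1) (by omega)]
    | succ n ih =>
      have h1 := (hu (m + n)).2.2.2 (v (m + n + 1)).1
      push_cast
      rw [← add_assoc]
      exact h1.2 ⟨hQ _, Or.inl ⟨_, ih, (hv (m + n)).1⟩⟩
  have h := key (l - m).toNat
  rw [← hl _ (by omega)] at h
  exact (hu _).2.1 h

theorem TD_nd {A : Type} [LinearOrder A] {T Q : A → A → Prop} {u v : ℤ → A × Set A}
    (hu : Path' (TD T Q) u) (hv : Path' (TD T Q) v) {k l : ℤ}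
    (hk : ∀ j ≤ k, u j = v j) (hl : ∀ j ≥ l, u j = v j) (hQ : ∀ j, Q (v j).1 (u j).1)
    (hQ' : ∀ j, Q (u j).1 (v j).1) : u = v := by
  have h1 : ∀ j, (u j).1 = (v j).1 := by
    by_contra hcon
    push Not at hcon
    obtain ⟨m, hm, hmm⟩ := Int.exists_least_of_bdd (P := fun j => (u j).1 ≠ (v j).1)
      ⟨k, fun z hz => by
        by_contra h
        exact hz (by rw [hk z (by omega)])⟩ hcon
    have hm' : ∀ j < m, (u j).1 = (v j).1 := fun j hj => by
      by_contra h
      have := hmm j h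
      omega
    rcases lt_or_gt_of_ne hm with h | h
    · exact TD_aux hv hu (fun j hj => (hm' j hj).symm) h (fun j hj => by rw [hl j hj]) hQ'
    · exact TD_aux hu hv hm' h (fun j hj => by rw [hl j hj]) hQ
  have h2 : ∀ n : ℕ, u (k + n) = v (k + n) := by
    intro n
    induction n with
    | zero => exact hk _ (by simp)
    | succ n ih =>
      push_cast
      rw [← add_assoc]
      refine Prod.ext (h1 _) (Set.ext fun c => ?_)
      rw [(hu (k + n)).2.2.2 c, (hv (k + n)).2.2.2 c, ih, h1 (k + n + 1)]
  funext j
  rcases le_or_gt j k with h | h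
  · exact hk j h
  · have := h2 (j - k).toNat
    rwa [show k + ((j - k).toNat : ℤ) = j by omega] at this

theorem remove_diamonds {A X : Type} [Finite A] [MetricSpace X] {F : Equiv.Perm X}
    {T Q : A → A → Prop} {p : (ℤ → A) → X} (hp : Pres F T p)
    (ess : ∀ a, ∃ t, Path' T t ∧ t 0 = a) {η : ℝ}
    (hfine : ∀ u v, Path' T u → Path' T v → u 0 = v 0 → dist (p u) (p v) ≤ η)
    (hQ : ∀ u v, Path' T u → Path' T v → (p u = p v ↔ ∀ j, Q (u j) (v j))) :
    ∃ (A' : Type) (_ : Finite A') (T' : A' → A' → Prop) (p' : (ℤ → A') → X), Pres F T' p' ∧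
      (∀ u v, Path' T' u → Path' T' v → u 0 = v 0 → dist (p' u) (p' v) ≤ η) ∧
      ∀ u v, Path' T' u → Path' T' v → ∀ k l : ℤ, (∀ j ≤ k, u j = v j) → (∀ j ≥ l, u j = v j) →
        p' u = p' v → u = v := by
  obtain ⟨n, ⟨e⟩⟩ := Finite.exists_equiv_fin A
  letI : LinearOrder A := LinearOrder.lift' e e.injective
  have Qr : ∀ a, Q a a := by
    intro a
    obtain ⟨t, ht, rfl⟩ := ess a
    exact (hQ t t ht ht).1 rfl 0
  have hf : ∀ u, Path' (TD T Q) u → Path' T (fun j => (u j).1) := fun u hu j => (hu j).1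
  refine ⟨A × Set A, inferInstance, TD T Q, fun s => p fun j => (s j).1, ⟨?_, ?_, ?_⟩, ?_, ?_⟩
  · intro ε hε
    obtain ⟨n, hn⟩ := hp.ucont ε hε
    exact ⟨n, fun u v hu hv h => hn _ _ (hf u hu) (hf v hv) fun j h1 h2 => by rw [h j h1 h2]⟩
  · intro x
    obtain ⟨t, ht, hx, hg⟩ := exists_good hp Qr hQ x
    obtain ⟨s, hs, hst⟩ := good_lift Qr ess ht hg
    exact ⟨s, hs, by simp only [hst]; exact hx⟩
  · intro t ht
    exact hp.eqv _ (hf t ht)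
  · intro u v hu hv h
    exact hfine _ _ (hf u hu) (hf v hv) (by rw [h])
  · intro u v hu hv k l hk hl h
    exact TD_nd hu hv hk hl ((hQ _ _ (hf v hv) (hf u hu)).1 h.symm) ((hQ _ _ (hf u hu) (hf v hv)).1 h)

theorem exists_recurrent {X : Type} [MetricSpace X] [CompactSpace X] [Nonempty X] {F : Equiv.Perm X}
    (h1 : Continuous F) (h2 : Continuous F.symm) (ht : TopTransitive F) :
    ∃ x, ∀ U : Set X, IsOpen U → U.Nonempty → ∀ N : ℕ, ∃ n ≥ N, (F ^ (n : ℤ)) x ∈ U := by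
  let B := TopologicalSpace.countableBasis X
  let G : B × ℕ → Set X := fun q => {x | ∃ n ≥ q.2, (F ^ (n : ℤ)) x ∈ q.1.1}
  have hcB : Countable B := (TopologicalSpace.countable_countableBasis X).to_subtype
  have hG : ∀ q, IsOpen (G q) := by
    intro q
    have : G q = ⋃ n : ℕ, ⋃ _ : n ≥ q.2, (F ^ (n : ℤ)) ⁻¹' q.1.1 := by
      ext x; simp [G]
    rw [this]
    refine isOpen_iUnion fun n => isOpen_iUnion fun _ => ?_
    exact (TopologicalSpace.isOpen_of_mem_countableBasis q.1.2).preimage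
      (continuous_zpow_perm F h1 h2 n)
  have hD : ∀ q, Dense (G q) := by
    intro q
    rw [dense_iff_inter_open]
    intro V hV hVn
    obtain ⟨y, hy⟩ := TopologicalSpace.nonempty_of_mem_countableBasis q.1.2
    obtain ⟨n, z, hz1, hz2⟩ := ht ((F ^ (q.2 : ℤ)) ⁻¹' q.1.1) V
      ((TopologicalSpace.isOpen_of_mem_countableBasis q.1.2).preimage
        (continuous_zpow_perm F h1 h2 q.2)) hV ⟨(F ^ (q.2 : ℤ)).symm y, by simpa using hy⟩ hVn
    refine ⟨z, hz2, q.2 + n, by omega, ?_⟩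
    have : (F ^ ((q.2 + n : ℕ) : ℤ)) z = (F ^ (q.2 : ℤ)) ((F ^ (n : ℤ)) z) := by
      rw [← Equiv.Perm.mul_apply, ← zpow_add]; push_cast; rfl
    rw [this]
    exact hz1
  obtain ⟨x, hx⟩ := (dense_iInter_of_isOpen hG hD).nonempty
  rw [mem_iInter] at hx
  refine ⟨x, fun U hU ⟨y, hy⟩ N => ?_⟩
  obtain ⟨b, hb, hyb, hbU⟩ :=
    (TopologicalSpace.isBasis_countableBasis X).exists_subset_of_mem_open hy hU
  obtain ⟨n, hn, hnx⟩ := hx (⟨b, hb⟩, N)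
  exact ⟨n, hn, hbU hnx⟩

theorem block_path {A : Type} {T : A → A → Prop} {P : ℤ} (hP : 0 < P) (G : ℤ → ℤ → A) (a : A)
    (h0 : ∀ m, G m 0 = a) (h1 : ∀ m, G m P = a)
    (hT : ∀ m j, 0 ≤ j → j < P → T (G m j) (G m (j + 1))) :
    Path' T (fun i => G (i / P) (i % P)) := by
  intro i
  have hr0 := Int.emod_nonneg i hP.ne'
  have hr1 := Int.emod_lt_of_pos i hP
  have hi := Int.emod_add_mul_ediv i P
  have h := hT (i / P) (i % P) hr0 hr1
  by_cases hc : i % P + 1 < P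
  · obtain ⟨e1, e2⟩ := (Int.ediv_emod_unique (a := i + 1) (q := i / P) (r := i % P + 1) hP).2
      ⟨by linarith, by omega, hc⟩
    simp only [e1, e2]
    exact h
  · have hc' : i % P + 1 = P := by omega
    obtain ⟨e1, e2⟩ := (Int.ediv_emod_unique (a := i + 1) (q := i / P + 1) (r := 0) hP).2
      ⟨by rw [mul_add]; linarith, le_rfl, hP⟩
    simp only [e1, e2, h0]
    rw [hc', h1] at h
    exact h

def Irr {A : Type} (T : A → A → Prop) : Prop := ∀ a b, ∃ n : ℤ, 0 < n ∧ ∃ w : ℤ → A,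
  w 0 = a ∧ w n = b ∧ ∀ j, 0 ≤ j → j < n → T (w j) (w (j + 1))

theorem Irr.ess {A : Type} {T : A → A → Prop} (h : Irr T) (a : A) : ∃ t, Path' T t ∧ t 0 = a := by
  obtain ⟨n, hn, w, h0, h1, hT⟩ := h a a
  exact ⟨_, block_path hn (fun _ => w) a (fun _ => h0) (fun _ => h1) (fun _ => hT), by simpa using h0⟩

theorem irreducible_component {A X : Type} [Finite A] [MetricSpace X] [CompactSpace X] [Nonempty X]
    {F : Equiv.Perm X} (h1 : Continuous F) (h2 : Continuous F.symm) (htr : TopTransitive F)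
    {T : A → A → Prop} {p : (ℤ → A) → X} (hp : Pres F T p) {η : ℝ}
    (hfine : ∀ u v, Path' T u → Path' T v → u 0 = v 0 → dist (p u) (p v) ≤ η)
    (hnd : ∀ u v, Path' T u → Path' T v → ∀ k l : ℤ, (∀ j ≤ k, u j = v j) → (∀ j ≥ l, u j = v j) →
        p u = p v → u = v) :
    ∃ (A' : Type) (_ : Finite A') (T' : A' → A' → Prop) (p' : (ℤ → A') → X), Pres F T' p' ∧
      Irr T' ∧
      (∀ u v, Path' T' u → Path' T' v → u 0 = v 0 → dist (p' u) (p' v) ≤ η) ∧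
      ∀ u v, Path' T' u → Path' T' v → ∀ k l : ℤ, (∀ j ≤ k, u j = v j) → (∀ j ≥ l, u j = v j) →
        p' u = p' v → u = v := by
  obtain ⟨x, hx⟩ := exists_recurrent h1 h2 htr
  obtain ⟨t, ht, rfl⟩ := hp.surj x
  let I : Set A := {a | ∃ᶠ i : ℕ in atTop, t i = a}
  have hev : ∃ i0 : ℕ, ∀ i ≥ i0, t i ∈ I := by
    rw [← eventually_atTop]
    have : ∀ a : A, ∀ᶠ i : ℕ in atTop, t i = a → a ∈ I := by
      intro a
      by_cases ha : a ∈ I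
      · exact Eventually.of_forall fun _ _ => ha
      · have := not_frequently.1 ha
        filter_upwards [this] with i hi h
        exact absurd h hi
    filter_upwards [eventually_all.2 this] with i hi
    exact hi _ rfl
  obtain ⟨i0, hi0⟩ := hev
  have hv : ∀ u : ℤ → I, Path' (fun a b : I => T a b) u → Path' T (fun j => (u j : A)) :=
    fun u hu j => hu j
  refine ⟨I, inferInstance, fun a b => T a b, fun s => p fun j => (s j : A),
    ⟨?_, ?_, ?_⟩, ?_, ?_, ?_⟩
  · intro ε hε
    obtain ⟨n, hn⟩ := hp.ucont ε hε
    exact ⟨n, fun u v hu hv' h => hn _ _ (hv u hu) (hv v hv') fun j h1 h2 => by rw [h j h1 h2]⟩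
  · intro y
    have hcl : MapClusterPt y atTop (fun n : ℕ => (F ^ (n : ℤ)) (p t)) := by
      rw [mapClusterPt_iff_frequently]
      intro s hs
      obtain ⟨U, hU, hUo, hyU⟩ := mem_nhds_iff.1 hs
      rw [frequently_atTop]
      intro N
      obtain ⟨n, hn, hnU⟩ := hx U hUo ⟨y, hyU⟩ N
      exact ⟨n, hn, hU hnU⟩
    obtain ⟨U, hU, hUt⟩ := mapClusterPt_iff_ultrafilter.1 hcl
    let s : ℕ → ℤ → A := fun n j => t (j + n)
    have hs : ∀ n, Path' T (s n) := fun n => path_shift ht n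
    obtain ⟨t', ht'⟩ := ultra_limit U s
    have hlim := ultra_tendsto hp U hs ht'
    have e : (fun n => p (s n)) = fun n : ℕ => (F ^ (n : ℤ)) (p t) :=
      funext fun n => eqv_zpow hp.eqv ht n
    rw [e] at hlim
    have hI : ∀ j, t' j ∈ I := by
      intro j
      change ∃ᶠ i : ℕ in atTop, t i = t' j
      rw [frequently_atTop]
      intro N
      obtain ⟨n, hn1, hn2⟩ := ((ht' j j).and (hU (eventually_ge_atTop (N + j.natAbs)))).exists
      refine ⟨(j + n).toNat, by omega, ?_⟩
      rw [show (((j + n).toNat : ℕ) : ℤ) = j + n by omega]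
      exact hn1 j le_rfl le_rfl
    exact ⟨fun j => ⟨t' j, hI j⟩, ultra_path U hs ht', tendsto_nhds_unique hlim hUt⟩
  · intro u hu
    exact hp.eqv _ (hv u hu)
  · rintro ⟨a, ha⟩ ⟨b, hb⟩
    obtain ⟨i1, hi1, rfl⟩ := frequently_atTop.1 ha i0
    obtain ⟨i2, hi2, rfl⟩ := frequently_atTop.1 hb (i1 + 1)
    refine ⟨i2 - i1, by omega, fun j => ⟨t ((i1 + j.toNat : ℕ) : ℤ), hi0 _ (by omega)⟩, ?_, ?_, ?_⟩
    · apply Subtype.ext; simp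
    · apply Subtype.ext
      change t _ = t _
      congr 1; omega
    · intro j hj hj'
      have := ht ((i1 + j.toNat : ℕ) : ℤ)
      change T (t _) (t _)
      rwa [show ((i1 + (j + 1).toNat : ℕ) : ℤ) = ((i1 + j.toNat : ℕ) : ℤ) + 1 by omega]
  · intro u v hu hv' h
    exact hfine _ _ (hv u hu) (hv v hv') (by rw [h])
  · intro u v hu hv' k l hk hl h
    have := hnd _ _ (hv u hu) (hv v hv') k l (fun j hj => by rw [hk j hj]) (fun j hj => by rw [hl j hj]) h
    funext j
    exact Subtype.ext (congrFun this j)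

theorem nd_factor {A X Y : Type} {T R : A → A → Prop} (hirr : Irr T) {p : (ℤ → A) → X} {π : X → Y}
    (hnd : ∀ u v, Path' T u → Path' T v → ∀ k l : ℤ, (∀ j ≤ k, u j = v j) → (∀ j ≥ l, u j = v j) →
        p u = p v → u = v)
    (hR : ∀ u v, Path' T u → Path' T v → (π (p u) = π (p v) ↔ ∀ j, R (u j) (v j)))
    (hfin : ∀ y, (π ⁻¹' {y}).Finite)
    {u v : ℤ → A} (hu : Path' T u) (hv : Path' T v) {k l : ℤ} (hk : ∀ j ≤ k, u j = v j)
    (hl : ∀ j ≥ l, u j = v j) (h : π (p u) = π (p v)) : u = v := by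
  have Rr : ∀ a, R a a := by
    intro a
    obtain ⟨t, ht, rfl⟩ := hirr.ess a
    exact (hR t t ht ht).1 rfl 0
  have huv := (hR u v hu hv).1 h
  have hvu := (hR v u hv hu).1 h.symm
  by_contra hne
  obtain ⟨j0, hj0⟩ := Function.ne_iff.1 hne
  have hj0k : k < j0 := by
    by_contra hc
    exact hj0 (hk _ (by omega))
  have hj0l : j0 < l := by
    by_contra hc
    exact hj0 (hl _ (by omega))
  obtain ⟨n', hn', w, hw0, hw1, hwT⟩ := hirr (u l) (u k)
  let g : (ℤ → A) → ℤ → A := fun s j => if j ≤ l - k then s (j + k) else w (j - (l - k))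
  obtain ⟨P, hP⟩ : ∃ P, P = l - k + n' := ⟨_, rfl⟩
  have hPpos : 0 < P := by omega
  have g1 : ∀ s j, j ≤ l - k → g s j = s (j + k) := fun s j hj => if_pos hj
  have g2 : ∀ s, s l = u l → ∀ j, l - k ≤ j → g s j = w (j - (l - k)) := by
    intro s hs j hj
    rcases hj.eq_or_lt with e | e
    · subst e
      rw [g1 _ _ le_rfl, sub_add_cancel, sub_self, hs, hw0]
    · exact if_neg (by omega)
  have g0 : ∀ s, s k = u k → g s 0 = u k := fun s hs => by rw [g1 _ _ (by omega), zero_add, hs]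
  have gP : ∀ s, s l = u l → g s P = u k := fun s hs => by
    rw [g2 s hs _ (by omega), hP, ← hw1]; congr 1; ring
  have gT : ∀ s, Path' T s → s l = u l → ∀ j, 0 ≤ j → j < P → T (g s j) (g s (j + 1)) := by
    intro s hs hsl j hj hj'
    rcases lt_or_ge j (l - k) with e | e
    · rw [g1 _ _ e.le, g1 _ _ (by omega), show j + 1 + k = j + k + 1 by ring]
      exact hs _
    · rw [g2 s hsl _ e, g2 s hsl _ (by omega), show j + 1 - (l - k) = j - (l - k) + 1 by ring]
      exact hwT _ (by omega) (by omega)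
  have hvk : v k = u k := (hk k le_rfl).symm
  have hvl : v l = u l := (hl l le_rfl).symm
  let t : ℕ → ℤ → A := fun n i => if i / P = n then g v (i % P) else g u (i % P)
  have htp : ∀ n, Path' T (t n) := by
    intro n
    refine block_path hPpos (fun m j => if m = n then g v j else g u j) (u k) ?_ ?_ ?_
    · intro m; split_ifs
      exacts [g0 v hvk, g0 u rfl]
    · intro m; split_ifs
      exacts [gP v hvl, gP u rfl]
    · intro m j hj hj'; split_ifs
      exacts [gT v hv hvl j hj hj', gT u hu rfl j hj hj']
  have gR : ∀ s s' : ℤ → A, (∀ j, R (s j) (s' j)) → ∀ j, R (g s j) (g s' j) := by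
    intro s s' hs j
    simp only [g]
    split_ifs
    exacts [hs _, Rr _]
  have hall : ∀ n m, π (p (t n)) = π (p (t m)) := by
    intro n m
    refine (hR _ _ (htp n) (htp m)).2 fun j => ?_
    simp only [t]
    split_ifs
    exacts [Rr _, gR _ _ hvu _, gR _ _ huv _, Rr _]
  have hfib : Finite (π ⁻¹' {π (p (t 0))}) := (hfin _).to_subtype
  obtain ⟨n, m, hnm, hpe⟩ := Finite.exists_ne_map_eq_of_infinite
    (fun n : ℕ => (⟨p (t n), hall n 0⟩ : π ⁻¹' {π (p (t 0))}))
  have hpe' : p (t n) = p (t m) := congrArg Subtype.val hpe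
  have key := hnd (t n) (t m) (htp n) (htp m) (-1) (P * (n + m + 1)) ?_ ?_ hpe'
  · have hq := (Int.ediv_emod_unique (a := j0 - k + P * n) (q := n) (r := j0 - k) hPpos).2
      ⟨rfl, by omega, by omega⟩
    have := congrFun key (j0 - k + P * n)
    simp only [t, hq.1, hq.2] at this
    rw [if_pos trivial, if_neg (by exact_mod_cast hnm), g1 _ _ (by omega), g1 _ _ (by omega),
      sub_add_cancel] at this
    exact hj0 this.symm
  · intro j hj
    have : j / P < 0 := Int.ediv_neg_of_neg_of_pos (by omega) hPpos
    simp only [t]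
    rw [if_neg (by omega), if_neg (by omega)]
  · intro j hj
    have : (n + m + 1 : ℤ) ≤ j / P := by
      rw [Int.le_ediv_iff_mul_le hPpos, mul_comm]; exact hj
    simp only [t]
    rw [if_neg (by omega), if_neg (by omega)]

theorem Pres.continuousOn {A X : Type} [TopologicalSpace A] [DiscreteTopology A] [MetricSpace X]
    {F : Equiv.Perm X} {T : A → A → Prop} {p : (ℤ → A) → X} (hp : Pres F T p) :
    ContinuousOn p {t | Path' T t} := by
  intro t ht
  rw [ContinuousWithinAt, Metric.tendsto_nhds]
  intro ε hε
  obtain ⟨n, hn⟩ := hp.ucont ε hε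
  have h1 : ∀ᶠ s in 𝓝 t, ∀ j ∈ Set.Icc (-(n : ℤ)) n, s j = t j := by
    refine (Set.finite_Icc (-(n : ℤ)) n).eventually_all.2 fun j _ => ?_
    have : IsOpen {s : ℤ → A | s j = t j} :=
      (isOpen_discrete ({t j} : Set A)).preimage (continuous_apply (A := fun _ : ℤ => A) j)
    exact this.mem_nhds rfl
  filter_upwards [mem_nhdsWithin_of_mem_nhds h1, self_mem_nhdsWithin] with s hs hs'
  exact hn s t hs' ht fun j h1 h2 => hs j ⟨h1, h2⟩

theorem stmt12_aux {X Y : Type} [MetricSpace X] [CompactSpace X] [MetricSpace Y] [CompactSpace Y]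
    (F : Equiv.Perm X) (f : Equiv.Perm Y)
    (hX : FinitelyPresented F) (hXt : TopTransitive F)
    (hY : FinitelyPresented f)
    (π : X → Y) (hπ : IsFactorMap F f π) (hfin : ∀ y : Y, (π ⁻¹' {y}).Finite) :
    ∃ (Xt Yt : Type) (mX : MetricSpace Xt) (cX : CompactSpace Xt)
      (mY : MetricSpace Yt) (cY : CompactSpace Yt)
      (Ft : Equiv.Perm Xt) (gt : Equiv.Perm Yt)
      (φ : Xt → X) (θ : Yt → Y) (πt : Xt → Yt),
      IsSmale Ft ∧ IsSmale gt ∧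
      IsFactorMap Ft F φ ∧ IsFactorMap gt f θ ∧ IsFactorMap Ft gt πt ∧
      UResolving Ft φ ∧ UResolving gt θ ∧ SResolving Ft πt ∧
      π ∘ φ = θ ∘ πt := by
  have hX' := hX
  obtain ⟨F1, F2, ⟨c, hc0, hc⟩, N, S, -, -, ⟨x0, -⟩, φ0, -⟩ := hX'
  obtain ⟨f1, f2, ⟨d, hd0, hd⟩, -⟩ := hY
  have hne : Nonempty X := ⟨φ0 x0⟩
  have huc : UniformContinuous π := CompactSpace.uniformContinuous_of_continuous hπ.1
  obtain ⟨δ, hδ0, hδ⟩ := Metric.uniformContinuous_iff.1 huc (d / 6) (by positivity)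
  obtain ⟨η, hη0, hηc, hηδ⟩ : ∃ η > 0, 6 * η ≤ c ∧ η < δ :=
    ⟨min (c / 6) (δ / 2), lt_min (by positivity) (by positivity),
      by have := min_le_left (c / 6) (δ / 2); linarith,
      by have := min_le_right (c / 6) (δ / 2); linarith⟩
  obtain ⟨A0, _, T0, p0, hp0, ess0, fine0⟩ := block_presentation hX hη0
  obtain ⟨Q0, M0, hQ0⟩ := relFacts_exists F1 F2 hc hp0.eqv hη0 hηc fine0
  obtain ⟨A1, _, T1, p1, hp1, fine1, nd1⟩ := remove_diamonds hp0 ess0 fine0 hQ0.iff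
  obtain ⟨A, _, T, p, hp, hirr, fine, nd⟩ := irreducible_component F1 F2 hXt hp1 fine1 nd1
  obtain ⟨Q, M1, hQ⟩ := relFacts_exists F1 F2 hc hp.eqv hη0 hηc fine
  obtain ⟨R, M2, hR⟩ := relFacts_exists (h := fun t => π (p t)) f1 f2 hd
    (fun t ht => by rw [hp.eqv t ht, hπ.2.2]) (ε := d / 6) (by positivity) (by linarith)
    (fun u v hu hv h => (hδ ((fine u v hu hv h).trans_lt hηδ)).le)
  have ess := hirr.ess
  have hC : Core T R Q (max M1 M2) := by
    refine ⟨ess, ?_, hR.symm, ?_, hQ.symm, ?_, ?_, ?_⟩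
    · intro a
      obtain ⟨t, ht, rfl⟩ := ess a
      exact (hR.iff t t ht ht).1 rfl 0
    · intro a
      obtain ⟨t, ht, rfl⟩ := ess a
      exact (hQ.iff t t ht ht).1 rfl 0
    · intro u v hu hv i h
      exact hR.R3 u v hu hv i fun j hj => h j (by push_cast; omega)
    · intro u v hu hv i h
      exact hQ.R3 u v hu hv i fun j hj => h j (by push_cast; omega)
    · intro u v hu hv k l hk hl h
      exact nd_factor hirr nd hR.iff hfin hu hv hk hl (hR.R3a u v hu hv h)
  letI : TopologicalSpace A := ⊥
  haveI : DiscreteTopology A := ⟨rfl⟩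
  exact core_main hC F f π hπ p hp.continuousOn hp.surj hp.eqv hQ.iff hR.iff

/-- Every finite-to-one factor map between transitive finitely presented
systems lifts through u-resolving maps to an s-resolving map between Smale spaces. -/
theorem stmt12 {X Y : Type} [MetricSpace X] [CompactSpace X] [MetricSpace Y] [CompactSpace Y]
    (F : Equiv.Perm X) (f : Equiv.Perm Y)
    (hX : FinitelyPresented F) (hXt : TopTransitive F)
    (hY : FinitelyPresented f) (hYt : TopTransitive f)
    (π : X → Y) (hπ : IsFactorMap F f π) (hfin : ∀ y : Y, (π ⁻¹' {y}).Finite) :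
    ∃ (Xt Yt : Type) (mX : MetricSpace Xt) (cX : CompactSpace Xt)
      (mY : MetricSpace Yt) (cY : CompactSpace Yt)
      (Ft : Equiv.Perm Xt) (gt : Equiv.Perm Yt)
      (φ : Xt → X) (θ : Yt → Y) (πt : Xt → Yt),
      IsSmale Ft ∧ IsSmale gt ∧
      IsFactorMap Ft F φ ∧ IsFactorMap gt f θ ∧ IsFactorMap Ft gt πt ∧
      UResolving Ft φ ∧ UResolving gt θ ∧ SResolving Ft πt ∧
      π ∘ φ = θ ∘ πt := by
  exact stmt12_aux F f hX hXt hY π hπ hfin
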